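/- arXiv:2105.04843 — 5 statements merged into one kernel-verified Lean document; each statement's English description precedes it below -/
import Mathlib

section
/- Let Γ ⊂ ℝ³ be a C² parametrized bounded surface with unit normal field n, and let ε > 0 be such that every x in the tubular neighborhood T(Γ;ε) = {x_Γ + s·n(x_Γ) : x_Γ ∈ Γ, s ∈ (−ε,ε)} has a unique nearest point P_Γ(x) ∈ Γ and P_Γ is continuous on T(Γ;ε). Let u ∈ C¹(ℝ³;ℝ³) satisfy u(ξ)·n(ξ) < 0 for every ξ ∈ Γ, and let X ∈ C¹(ℝ×ℝ³;ℝ³) satisfy ∂_s X(s,x) = −u(X(s,x)) and X(0,x) = x. Then for every compact set K ⊂ Γ there exists δ > 0 such that for all ξ ∈ K and all s ∈ (−δ,δ) one has X(s,ξ) ∈ T(Γ;ε), and moreover for all ξ ∈ K and all s ∈ (0,δ) one has ( X(s,ξ) − P_Γ(X(s,ξ)) ) · n( P_Γ(X(s,ξ)) ) > 0, i.e. X(s,ξ) lies in the one-sided tube T^+(Γ;ε) = {x_Γ + s·n(x_Γ) : x_Γ ∈ Γ, s ∈ (0,ε)}. -/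
open Metric Set
open scoped RealInnerProductSpace

noncomputable section

/-- The cross product on `ℝ³`. -/
def cross3 (a b : EuclideanSpace ℝ (Fin 3)) : EuclideanSpace ℝ (Fin 3) :=
  (EuclideanSpace.equiv (Fin 3) ℝ).symm
    ![a 1 * b 2 - a 2 * b 1, a 2 * b 0 - a 0 * b 2, a 0 * b 1 - a 1 * b 0]

/-- The two-sided tubular neighborhood `T(Γ;ε)` of a surface `Γ` with normal field `n`. -/
def tube (Γ : Set (EuclideanSpace ℝ (Fin 3)))
    (n : EuclideanSpace ℝ (Fin 3) → EuclideanSpace ℝ (Fin 3)) (ε : ℝ) :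
    Set (EuclideanSpace ℝ (Fin 3)) :=
  {x | ∃ y ∈ Γ, ∃ s ∈ Set.Ioo (-ε) ε, x = y + s • n y}

/-- The outer one-sided tube `T⁺(Γ;ε)` (`s ∈ (0,ε)`). -/
def tubePlus (Γ : Set (EuclideanSpace ℝ (Fin 3)))
    (n : EuclideanSpace ℝ (Fin 3) → EuclideanSpace ℝ (Fin 3)) (ε : ℝ) :
    Set (EuclideanSpace ℝ (Fin 3)) :=
  {x | ∃ y ∈ Γ, ∃ s ∈ Set.Ioo (0 : ℝ) ε, x = y + s • n y}

/-- A continuous injective map on a compact set has a continuous inverse: points of the compact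
set whose image is close to `f a` are close to `a`. -/
theorem IsCompact.eventually_mem_of_injOn {α β : Type*} [TopologicalSpace α] [TopologicalSpace β]
    [T2Space β] {S : Set α} (hS : IsCompact S) {f : α → β} (hf : ContinuousOn f S)
    (hinj : InjOn f S) {a : α} (ha : a ∈ S) {U : Set α} (hU : U ∈ nhds a) :
    ∀ᶠ y in nhds (f a), ∀ z ∈ S, f z = y → z ∈ U := by
  have hcomp : IsCompact (f '' (S \ interior U)) :=
    (hS.diff isOpen_interior).image_of_continuousOn (hf.mono sdiff_subset)
  have hnot : f a ∉ f '' (S \ interior U) := by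
    rintro ⟨z, ⟨hz, hzU⟩, hza⟩
    exact hzU (hinj hz ha hza ▸ mem_interior_iff_mem_nhds.2 hU)
  filter_upwards [hcomp.isClosed.isOpen_compl.mem_nhds hnot] with y hy z hz hzy
  by_contra hzU
  exact hy ⟨z, ⟨hz, fun h => hzU (interior_subset h)⟩, hzy⟩

/-- Near a point where a `C¹` map is immersive, the first order Taylor remainder is small compared
with the increment of the map. -/
theorem eventually_norm_sub_fderiv_le {E F : Type*} [NormedAddCommGroup E]
    [NormedSpace ℝ E] [FiniteDimensional ℝ E] [NormedAddCommGroup F] [NormedSpace ℝ F]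
    {G : E → F} {a : E} (hG : ContDiffAt ℝ 1 G a) (hinj : Function.Injective (fderiv ℝ G a))
    {η : ℝ} (hη : 0 < η) :
    ∀ᶠ p in nhds (a, a),
      ‖G p.1 - G p.2 - fderiv ℝ G p.2 (p.1 - p.2)‖ ≤ η * ‖G p.1 - G p.2‖ := by
  obtain ⟨C, hC, hanti⟩ := (fderiv ℝ G a).toLinearMap.exists_antilipschitzWith
    (LinearMap.ker_eq_bot.2 hinj)
  have hC' : (0 : ℝ) < C := hC
  have hbound : ∀ h, ‖h‖ ≤ C * ‖fderiv ℝ G a h‖ := fun h => by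
    simpa using hanti.le_mul_dist h 0
  obtain ⟨κ, hκ, hκ₁, hκ₂⟩ : ∃ κ : ℝ, 0 < κ ∧ C * κ ≤ 1 / 2 ∧ 4 * C * κ ≤ η := by
    refine ⟨min (1 / (2 * C) : ℝ) (η / (4 * C)), by positivity, ?_, ?_⟩
    · calc (C : ℝ) * min (1 / (2 * C) : ℝ) (η / (4 * C)) ≤ C * (1 / (2 * C)) := by
            gcongr; exact min_le_left _ _
        _ = 1 / 2 := by field_simp
    · calc 4 * (C : ℝ) * min (1 / (2 * C) : ℝ) (η / (4 * C)) ≤ 4 * C * (η / (4 * C)) := by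
            gcongr; exact min_le_right _ _
        _ = η := by field_simp
  have hstrict := (hG.hasStrictFDerivAt one_ne_zero).isLittleO.bound hκ
  have hcont : ContinuousAt (fderiv ℝ G) a :=
    (hG.fderiv_right (m := 0) (by norm_num)).continuousAt
  have hnear : ∀ᶠ p : E × E in nhds (a, a), dist (fderiv ℝ G p.2) (fderiv ℝ G a) < κ :=
    (hcont.tendsto.comp (continuous_snd.tendsto (a, a))).eventually (Metric.ball_mem_nhds _ hκ)
  filter_upwards [hstrict, hnear] with p hp hd
  set h := p.1 - p.2
  have hlow : ‖h‖ ≤ 2 * C * ‖G p.1 - G p.2‖ := by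
    have htri : ‖fderiv ℝ G a h‖ ≤ ‖G p.1 - G p.2‖ + κ * ‖h‖ := by
      have := norm_sub_norm_le (fderiv ℝ G a h) (G p.1 - G p.2)
      rw [norm_sub_rev (fderiv ℝ G a h)] at this
      linarith
    have h₁ := (hbound h).trans (mul_le_mul_of_nonneg_left htri hC'.le)
    have h₂ := mul_le_mul_of_nonneg_right hκ₁ (norm_nonneg h)
    linarith
  have hdiff : ‖(fderiv ℝ G a - fderiv ℝ G p.2) h‖ ≤ κ * ‖h‖ := by
    refine ((fderiv ℝ G a - fderiv ℝ G p.2).le_opNorm h).trans ?_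
    rw [← dist_eq_norm, dist_comm]
    gcongr
  calc ‖G p.1 - G p.2 - fderiv ℝ G p.2 h‖
      = ‖(G p.1 - G p.2 - fderiv ℝ G a h) + (fderiv ℝ G a - fderiv ℝ G p.2) h‖ := by
        congr 1; simp
    _ ≤ κ * ‖h‖ + κ * ‖h‖ := (norm_add_le _ _).trans (add_le_add hp hdiff)
    _ ≤ 2 * κ * (2 * C * ‖G p.1 - G p.2‖) := by nlinarith
    _ = 4 * C * κ * ‖G p.1 - G p.2‖ := by ring
    _ ≤ η * ‖G p.1 - G p.2‖ := by gcongr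

/-- If `G a` is a nearest point to `x` among the values of `G` near `a`, then `x - G a` is
orthogonal to the range of the derivative of `G` at `a`. -/
theorem inner_sub_fderiv_eq_zero_of_isLocalMin_dist {E F : Type*} [NormedAddCommGroup E]
    [NormedSpace ℝ E] [NormedAddCommGroup F] [InnerProductSpace ℝ F] {G : E → F} {a : E} {x : F}
    (hG : DifferentiableAt ℝ G a) (hmin : IsLocalMin (fun z => dist x (G z)) a) (h : E) :
    ⟪x - G a, fderiv ℝ G a h⟫ = 0 := by
  have hmin' : IsLocalMin (fun z => ‖x - G z‖ ^ 2) a := by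
    filter_upwards [hmin] with z hz
    simp only [dist_eq_norm] at hz
    gcongr
  have h0 := hmin'.hasFDerivAt_eq_zero ((hG.hasFDerivAt.const_sub x).norm_sq)
  have h1 := DFunLike.congr_fun h0 h
  simp [inner_sub_left] at h1 ⊢
  linarith

theorem cross3_apply_zero (a b : EuclideanSpace ℝ (Fin 3)) :
    cross3 a b 0 = a 1 * b 2 - a 2 * b 1 := rfl

theorem cross3_apply_one (a b : EuclideanSpace ℝ (Fin 3)) :
    cross3 a b 1 = a 2 * b 0 - a 0 * b 2 := rfl

theorem cross3_apply_two (a b : EuclideanSpace ℝ (Fin 3)) :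
    cross3 a b 2 = a 0 * b 1 - a 1 * b 0 := rfl

theorem inner_eq_sum_three (a b : EuclideanSpace ℝ (Fin 3)) :
    ⟪a, b⟫ = a 0 * b 0 + a 1 * b 1 + a 2 * b 2 := by
  simp [PiLp.inner_apply, Fin.sum_univ_three, mul_comm]

theorem inner_left_cross3 (a b : EuclideanSpace ℝ (Fin 3)) : ⟪a, cross3 a b⟫ = 0 := by
  rw [inner_eq_sum_three, cross3_apply_zero, cross3_apply_one, cross3_apply_two]; ring

theorem inner_right_cross3 (a b : EuclideanSpace ℝ (Fin 3)) : ⟪b, cross3 a b⟫ = 0 := by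
  rw [inner_eq_sum_three, cross3_apply_zero, cross3_apply_one, cross3_apply_two]; ring

/-- A vector orthogonal to `a` and `b` is a multiple of their cross product. -/
theorem inner_cross3_self_smul_eq {a b w : EuclideanSpace ℝ (Fin 3)} (ha : ⟪w, a⟫ = 0)
    (hb : ⟪w, b⟫ = 0) :
    ⟪cross3 a b, cross3 a b⟫ • w = ⟪w, cross3 a b⟫ • cross3 a b := by
  rw [inner_eq_sum_three] at ha hb
  ext i
  fin_cases i <;>
    simp only [PiLp.smul_apply, smul_eq_mul, inner_eq_sum_three, cross3_apply_zero,
      cross3_apply_one, cross3_apply_two, Fin.zero_eta, Fin.mk_one, Fin.reduceFinMk]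
  · linear_combination
      ((a 2 * b 0 - a 0 * b 2) * a 2 - (a 0 * b 1 - a 1 * b 0) * a 1) * hb -
        ((a 2 * b 0 - a 0 * b 2) * b 2 - (a 0 * b 1 - a 1 * b 0) * b 1) * ha
  · linear_combination
      ((a 0 * b 1 - a 1 * b 0) * a 0 - (a 1 * b 2 - a 2 * b 1) * a 2) * hb -
        ((a 0 * b 1 - a 1 * b 0) * b 0 - (a 1 * b 2 - a 2 * b 1) * b 2) * ha
  · linear_combination
      ((a 1 * b 2 - a 2 * b 1) * a 1 - (a 2 * b 0 - a 0 * b 2) * a 0) * hb -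
        ((a 1 * b 2 - a 2 * b 1) * b 1 - (a 2 * b 0 - a 0 * b 2) * b 0) * ha

/-- The triple product expansion of `(a × b) × a` when the cross product vanishes. -/
theorem inner_self_smul_eq_of_cross3_eq_zero {a b : EuclideanSpace ℝ (Fin 3)}
    (h : cross3 a b = 0) : ⟪a, a⟫ • b = ⟪a, b⟫ • a := by
  have h0 := congrArg (fun v : EuclideanSpace ℝ (Fin 3) => v 0) h
  have h1 := congrArg (fun v : EuclideanSpace ℝ (Fin 3) => v 1) h
  have h2 := congrArg (fun v : EuclideanSpace ℝ (Fin 3) => v 2) h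
  simp only [cross3_apply_zero, cross3_apply_one, cross3_apply_two, PiLp.zero_apply] at h0 h1 h2
  ext i
  fin_cases i <;>
    simp only [PiLp.smul_apply, smul_eq_mul, inner_eq_sum_three, Fin.zero_eta, Fin.mk_one,
      Fin.reduceFinMk]
  · linear_combination a 2 * h1 - a 1 * h2
  · linear_combination a 0 * h2 - a 2 * h0
  · linear_combination a 1 * h0 - a 0 * h1

theorem continuous_cross3 :
    Continuous fun p : EuclideanSpace ℝ (Fin 3) × EuclideanSpace ℝ (Fin 3) => cross3 p.1 p.2 := by
  unfold cross3
  fun_prop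

theorem cross3_apply_single_ne_zero
    {D : EuclideanSpace ℝ (Fin 2) →L[ℝ] EuclideanSpace ℝ (Fin 3)} (hD : Function.Injective D) :
    cross3 (D (EuclideanSpace.single 0 1)) (D (EuclideanSpace.single 1 1)) ≠ 0 := by
  intro h
  have h1 := inner_self_smul_eq_of_cross3_eq_zero h
  rw [← map_smul, ← map_smul] at h1
  have h2 := congrArg (fun v : EuclideanSpace ℝ (Fin 2) => v 1) (hD h1)
  have h3 : D (EuclideanSpace.single 0 1) = 0 := by simpa using h2
  have h4 := congrArg (fun v : EuclideanSpace ℝ (Fin 2) => v 0) (hD (h3.trans (map_zero D).symm))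
  simp at h4

/-- The unit normal to the range of an injective linear map `ℝ² → ℝ³`. -/
def unitNormal (D : EuclideanSpace ℝ (Fin 2) →L[ℝ] EuclideanSpace ℝ (Fin 3)) :
    EuclideanSpace ℝ (Fin 3) :=
  ‖cross3 (D (EuclideanSpace.single 0 1)) (D (EuclideanSpace.single 1 1))‖⁻¹ •
    cross3 (D (EuclideanSpace.single 0 1)) (D (EuclideanSpace.single 1 1))

theorem norm_unitNormal {D : EuclideanSpace ℝ (Fin 2) →L[ℝ] EuclideanSpace ℝ (Fin 3)}
    (hD : Function.Injective D) : ‖unitNormal D‖ = 1 := by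
  have h := norm_ne_zero_iff.2 (cross3_apply_single_ne_zero hD)
  rw [unitNormal, norm_smul, norm_inv, norm_norm, inv_mul_cancel₀ h]

theorem inner_apply_unitNormal (D : EuclideanSpace ℝ (Fin 2) →L[ℝ] EuclideanSpace ℝ (Fin 3))
    (h : EuclideanSpace ℝ (Fin 2)) : ⟪D h, unitNormal D⟫ = 0 := by
  have hh : h = h 0 • EuclideanSpace.single 0 (1 : ℝ) + h 1 • EuclideanSpace.single 1 (1 : ℝ) := by
    ext i
    fin_cases i <;> simp
  rw [hh, map_add, map_smul, map_smul, unitNormal, inner_smul_right, inner_add_left,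
    inner_smul_left, inner_smul_left, inner_left_cross3, inner_right_cross3]
  simp

theorem eq_inner_smul_unitNormal {D : EuclideanSpace ℝ (Fin 2) →L[ℝ] EuclideanSpace ℝ (Fin 3)}
    (hD : Function.Injective D) {w : EuclideanSpace ℝ (Fin 3)} (hw : ∀ h, ⟪w, D h⟫ = 0) :
    w = ⟪w, unitNormal D⟫ • unitNormal D := by
  have hc := norm_ne_zero_iff.2 (cross3_apply_single_ne_zero hD)
  have key := inner_cross3_self_smul_eq (hw (EuclideanSpace.single 0 1))
    (hw (EuclideanSpace.single 1 1))
  rw [real_inner_self_eq_norm_sq] at key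
  have hw' : w = (‖cross3 (D (EuclideanSpace.single 0 1)) (D (EuclideanSpace.single 1 1))‖ ^ 2)⁻¹ •
      ⟪w, cross3 (D (EuclideanSpace.single 0 1)) (D (EuclideanSpace.single 1 1))⟫ •
        cross3 (D (EuclideanSpace.single 0 1)) (D (EuclideanSpace.single 1 1)) := by
    rw [← key, inv_smul_smul₀ (pow_ne_zero 2 hc)]
  conv_lhs => rw [hw']
  rw [unitNormal, inner_smul_right, smul_smul, smul_smul]
  congr 1
  ring

theorem continuousAt_unitNormal {D : EuclideanSpace ℝ (Fin 2) →L[ℝ] EuclideanSpace ℝ (Fin 3)}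
    (hD : Function.Injective D) : ContinuousAt unitNormal D := by
  have hc : Continuous fun D : EuclideanSpace ℝ (Fin 2) →L[ℝ] EuclideanSpace ℝ (Fin 3) =>
      cross3 (D (EuclideanSpace.single 0 1)) (D (EuclideanSpace.single 1 1)) :=
    continuous_cross3.comp (by fun_prop : Continuous fun
      D : EuclideanSpace ℝ (Fin 2) →L[ℝ] EuclideanSpace ℝ (Fin 3) =>
        (D (EuclideanSpace.single 0 1), D (EuclideanSpace.single 1 1)))
  exact (hc.norm.continuousAt.inv₀ (norm_ne_zero_iff.2 (cross3_apply_single_ne_zero hD))).smul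
    hc.continuousAt

/-- A point differs from a nearest point of an immersed surface by a multiple of the normal. -/
theorem eq_add_inner_smul_unitNormal {O : Set (EuclideanSpace ℝ (Fin 2))} (hO : IsOpen O)
    {G : EuclideanSpace ℝ (Fin 2) → EuclideanSpace ℝ (Fin 3)} {a : EuclideanSpace ℝ (Fin 2)}
    (ha : a ∈ O) (hG : DifferentiableAt ℝ G a) (hinj : Function.Injective (fderiv ℝ G a))
    {x : EuclideanSpace ℝ (Fin 3)} (hmin : ∀ z ∈ O, dist x (G a) ≤ dist x (G z)) :
    x = G a + ⟪x - G a, unitNormal (fderiv ℝ G a)⟫ • unitNormal (fderiv ℝ G a) := by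
  rw [← eq_inner_smul_unitNormal hinj (inner_sub_fderiv_eq_zero_of_isLocalMin_dist hG
    (Filter.mem_of_superset (hO.mem_nhds ha) hmin)), add_sub_cancel]

/-- The tube around a surface parametrized injectively over a compact closure is a neighborhood
of every point of the surface. -/
theorem eventually_mem_tube {O : Set (EuclideanSpace ℝ (Fin 2))} (hO : IsOpen O)
    (hObdd : Bornology.IsBounded O)
    {G : EuclideanSpace ℝ (Fin 2) → EuclideanSpace ℝ (Fin 3)}
    (hGcont : ContinuousOn G (closure O)) (hGinj : InjOn G (closure O))
    (hGdiff : ∀ z ∈ O, DifferentiableAt ℝ G z)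
    (hGimm : ∀ z ∈ O, Function.Injective (fderiv ℝ G z))
    {n : EuclideanSpace ℝ (Fin 3) → EuclideanSpace ℝ (Fin 3)}
    (hn : ∀ z ∈ O, n (G z) = unitNormal (fderiv ℝ G z)) {ε : ℝ} (hε : 0 < ε)
    {a : EuclideanSpace ℝ (Fin 2)} (ha : a ∈ O) :
    ∀ᶠ x in nhds (G a), x ∈ tube (G '' O) n ε := by
  have hcomp : IsCompact (closure O) := hObdd.isCompact_closure
  obtain ⟨r, hr, hball⟩ := Metric.eventually_nhds_iff_ball.1
    (hcomp.eventually_mem_of_injOn hGcont hGinj (subset_closure ha) (hO.mem_nhds ha))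
  filter_upwards [Metric.ball_mem_nhds (G a) (lt_min (half_pos hr) hε)] with x hx
  rw [Metric.mem_ball, lt_min_iff] at hx
  obtain ⟨z, hz, hzmin⟩ := hcomp.exists_isMinOn ⟨a, subset_closure ha⟩
    ((continuous_const.dist continuous_id).comp_continuousOn hGcont :
      ContinuousOn (fun z => dist x (G z)) (closure O))
  have hza : dist x (G z) ≤ dist x (G a) := hzmin (subset_closure ha)
  have hzO : z ∈ O := by
    refine hball (G z) ?_ z hz rfl
    have := dist_triangle_left (G z) (G a) x
    rw [Metric.mem_ball]
    linarith
  refine ⟨G z, mem_image_of_mem G hzO, ⟪x - G z, unitNormal (fderiv ℝ G z)⟫, ?_, ?_⟩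
  · rw [mem_Ioo, ← abs_lt]
    refine (abs_real_inner_le_norm _ _).trans_lt ?_
    rw [norm_unitNormal (hGimm z hzO), mul_one, ← dist_eq_norm]
    linarith
  · rw [hn z hzO]
    exact eq_add_inner_smul_unitNormal hO hzO (hGdiff z hzO) (hGimm z hzO)
      fun y hy => hzmin (subset_closure hy)

/-- If a flow `X` crosses a surface in the direction of its normal, then shortly after leaving the
surface it is on the outer side of every surface point at least as close as the starting point. -/
theorem eventually_inner_sub_unitNormal_pos {O : Set (EuclideanSpace ℝ (Fin 2))}
    (hObdd : Bornology.IsBounded O)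
    {G : EuclideanSpace ℝ (Fin 2) → EuclideanSpace ℝ (Fin 3)}
    (hGcont : ContinuousOn G (closure O)) (hGinj : InjOn G (closure O))
    (hGdiff : ∀ z ∈ O, ContDiffAt ℝ 1 G z)
    (hGimm : ∀ z ∈ O, Function.Injective (fderiv ℝ G z))
    {X : ℝ × EuclideanSpace ℝ (Fin 3) → EuclideanSpace ℝ (Fin 3)}
    {a : EuclideanSpace ℝ (Fin 2)} (ha : a ∈ O) (hX : ContDiffAt ℝ 1 X (0, G a))
    (hX0 : ∀ x, X (0, x) = x) {v : EuclideanSpace ℝ (Fin 3)}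
    (hv : HasDerivAt (fun t => X (t, G a)) v 0) (hpos : 0 < ⟪v, unitNormal (fderiv ℝ G a)⟫) :
    ∀ᶠ q in nhds ((0 : ℝ), G a), 0 < q.1 → q.2 ∈ G '' O → ∀ z ∈ O,
      dist (X q) (G z) ≤ dist (X q) q.2 →
        0 < ⟪X q - G z, unitNormal (fderiv ℝ G z)⟫ := by
  set c := ⟪v, unitNormal (fderiv ℝ G a)⟫
  set M := ‖v‖ + c with hM
  have hMpos : 0 < M := by positivity
  have hη : 0 < c / (16 * M) := by positivity
  have htaylor := eventually_norm_sub_fderiv_le (hGdiff a ha) (hGimm a ha) hη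
  rw [nhds_prod_eq] at htaylor
  obtain ⟨U, hU, htaylor⟩ := Filter.eventually_prod_self_iff'.1 htaylor
  have hnormal : ∀ᶠ z in nhds a, c / 2 < ⟪v, unitNormal (fderiv ℝ G z)⟫ := by
    have hcont : ContinuousAt (fun z => ⟪v, unitNormal (fderiv ℝ G z)⟫) a := by
      have hfd : ContinuousAt (fderiv ℝ G) a :=
        ((hGdiff a ha).fderiv_right (m := 0) (by norm_num)).continuousAt
      exact continuousAt_const.inner
        (ContinuousAt.comp (f := fderiv ℝ G) (continuousAt_unitNormal (hGimm a ha)) hfd)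
    exact hcont.eventually_const_lt (half_lt_self hpos)
  obtain ⟨r, hr, hball⟩ := Metric.eventually_nhds_iff_ball.1
    (hObdd.isCompact_closure.eventually_mem_of_injOn hGcont hGinj (subset_closure ha)
      (Filter.inter_mem hU hnormal))
  have hXv : fderiv ℝ X (0, G a) (1, 0) = v := by
    have hline : HasDerivAt (fun t : ℝ => (t, G a)) (1, 0) 0 :=
      (hasDerivAt_id 0).prodMk (hasDerivAt_const 0 (G a))
    exact ((hX.differentiableAt one_ne_zero).hasFDerivAt.comp_hasDerivAt (0 : ℝ) hline).unique hv
  have hstart : Filter.Tendsto (fun q : ℝ × EuclideanSpace ℝ (Fin 3) => (q, ((0 : ℝ), q.2)))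
      (nhds (0, G a)) (nhds ((0, G a), (0, G a))) :=
    Continuous.tendsto' (by fun_prop) _ _ rfl
  have hflow := hstart.eventually ((hX.hasStrictFDerivAt one_ne_zero).isLittleO.bound
    (by positivity : 0 < c / 4))
  have hclose : ∀ᶠ q in nhds ((0 : ℝ), G a), dist (X q) q.2 + dist (X q) (G a) < r := by
    have hcont : ContinuousAt (fun q => dist (X q) q.2 + dist (X q) (G a)) (0, G a) :=
      (hX.continuousAt.dist continuousAt_snd).add (hX.continuousAt.dist continuousAt_const)
    exact hcont.eventually_lt_const (by simpa [hX0] using hr)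
  have hsnd : ∀ᶠ q in nhds ((0 : ℝ), G a), q.2 ∈ Metric.ball (G a) r :=
    continuousAt_snd.eventually (Metric.ball_mem_nhds _ hr)
  filter_upwards [hflow, hclose, hsnd] with q hflow hclose hsnd hq hqΓ z hz hdist
  obtain ⟨s, ξ⟩ := q
  obtain ⟨y, hy, rfl⟩ := hqΓ
  dsimp only at *
  set x := X (s, G y)
  obtain ⟨hyU, -⟩ := hball _ hsnd y (subset_closure hy) rfl
  obtain ⟨hzU, hzn⟩ := hball (G z) (by
    have := dist_triangle_left (G z) (G a) x
    rw [Metric.mem_ball]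
    linarith) z (subset_closure hz) rfl
  have hzn : c / 2 < ⟪v, unitNormal (fderiv ℝ G z)⟫ := hzn
  have hflow : ‖x - G y - s • v‖ ≤ c / 4 * s := by
    have hsv : fderiv ℝ X (0, G a) (s, 0) = s • v := by
      rw [← hXv, ← map_smul]; simp
    simpa [hX0, hsv, abs_of_pos hq, max_eq_left hq.le] using hflow
  have hxy : dist x (G y) ≤ M * s := by
    have := norm_sub_norm_le (x - G y) (s • v)
    rw [norm_smul, Real.norm_of_nonneg hq.le] at this
    rw [dist_eq_norm, hM]
    nlinarith
  have hyz : ‖G y - G z‖ ≤ 2 * (M * s) := by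
    have := dist_triangle_left (G y) (G z) x
    rw [dist_eq_norm (G y)] at this
    linarith
  set ν := unitNormal (fderiv ℝ G z)
  have hν1 : ‖ν‖ = 1 := norm_unitNormal (hGimm z hz)
  have hinner : ∀ w, -‖w‖ ≤ ⟪w, ν⟫ := fun w => by
    have := neg_le_of_abs_le (abs_real_inner_le_norm w ν)
    rwa [hν1, mul_one] at this
  have hflowν := hinner (x - G y - s • v)
  have htaylorν := hinner (G y - G z - fderiv ℝ G z (y - z))
  have hremainder : ‖G y - G z - fderiv ℝ G z (y - z)‖ ≤ c / 8 * s := by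
    calc ‖G y - G z - fderiv ℝ G z (y - z)‖ ≤ c / (16 * M) * ‖G y - G z‖ := htaylor y hyU z hzU
      _ ≤ c / (16 * M) * (2 * (M * s)) := by gcongr
      _ = c / 8 * s := by field_simp; ring
  have hsplit : ⟪x - G z, ν⟫ = s * ⟪v, ν⟫ + ⟪x - G y - s • v, ν⟫ +
      ⟪G y - G z - fderiv ℝ G z (y - z), ν⟫ := by
    rw [inner_sub_left _ (fderiv ℝ G z (y - z)), inner_apply_unitNormal, inner_sub_left _ (s • v),
      real_inner_smul_left]
    simp only [inner_sub_left]
    ring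
  rw [hsplit]
  nlinarith [mul_pos hpos hq]

/-- If `u·n < 0` on a `C²` parametrized bounded surface `Γ` (inflow), `X` is the flow of
`-u`, and points of the tube `T(Γ;ε)` have a unique nearest-point projection `P` continuous
on the tube, then for every compact `K ⊆ Γ` there is `δ > 0` such that trajectories
`X(s,ξ)`, `ξ ∈ K`, stay in `T(Γ;ε)` for `|s| < δ` and lie on the outer side
(`(X(s,ξ) - P(X(s,ξ)))·n(P(X(s,ξ))) > 0`, i.e. in `T⁺(Γ;ε)`) for `s ∈ (0,δ)`. -/
theorem stmt3
    (O : Set (EuclideanSpace ℝ (Fin 2)))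
    (hOopen : IsOpen O) (hOconn : IsConnected O) (hObdd : Bornology.IsBounded O)
    (G : EuclideanSpace ℝ (Fin 2) → EuclideanSpace ℝ (Fin 3))
    (Γ : Set (EuclideanSpace ℝ (Fin 3)))
    (hG_smooth : ContDiffOn ℝ 2 G (closure O))
    (hG_bij : Set.BijOn G (closure O) (closure Γ))
    (hG_image : G '' O = Γ)
    (hG_imm : ∀ ζ ∈ O, Function.Injective (fderiv ℝ G ζ))
    (n : EuclideanSpace ℝ (Fin 3) → EuclideanSpace ℝ (Fin 3))
    (hn : ∀ ζ ∈ O,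
      n (G ζ) =
        ‖cross3 (fderiv ℝ G ζ (EuclideanSpace.single 0 1))
            (fderiv ℝ G ζ (EuclideanSpace.single 1 1))‖⁻¹ •
          cross3 (fderiv ℝ G ζ (EuclideanSpace.single 0 1))
            (fderiv ℝ G ζ (EuclideanSpace.single 1 1)))
    (ε : ℝ) (hε : 0 < ε)
    (P : EuclideanSpace ℝ (Fin 3) → EuclideanSpace ℝ (Fin 3))
    (hP : ∀ x ∈ tube Γ n ε,
      P x ∈ Γ ∧ dist x (P x) = infDist x Γ ∧
      ∀ y ∈ Γ, dist x y = infDist x Γ → y = P x)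
    (hPcont : ContinuousOn P (tube Γ n ε))
    (u : EuclideanSpace ℝ (Fin 3) → EuclideanSpace ℝ (Fin 3))
    (hu : ContDiff ℝ 1 u)
    (hun : ∀ ξ ∈ Γ, ⟪u ξ, n ξ⟫ < (0 : ℝ))
    (X : ℝ × EuclideanSpace ℝ (Fin 3) → EuclideanSpace ℝ (Fin 3))
    (hX : ContDiff ℝ 1 X)
    (hX0 : ∀ x, X (0, x) = x)
    (hXode : ∀ (s : ℝ) (x : EuclideanSpace ℝ (Fin 3)),
      HasDerivAt (fun t => X (t, x)) (-(u (X (s, x)))) s) :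
    ∀ K : Set (EuclideanSpace ℝ (Fin 3)), K ⊆ Γ → IsCompact K →
      ∃ δ > (0 : ℝ), ∀ ξ ∈ K,
        (∀ s ∈ Set.Ioo (-δ) δ, X (s, ξ) ∈ tube Γ n ε) ∧
        (∀ s ∈ Set.Ioo (0 : ℝ) δ,
          (0 : ℝ) < ⟪X (s, ξ) - P (X (s, ξ)), n (P (X (s, ξ)))⟫ ∧
          X (s, ξ) ∈ tubePlus Γ n ε) := by
  intro K hKΓ hK
  subst hG_image
  have hGdiff : ∀ z ∈ O, ContDiffAt ℝ 1 G z := fun z hz =>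
    ((hG_smooth.mono subset_closure).contDiffAt (hOopen.mem_nhds hz)).of_le (by norm_num)
  have hlocal : ∀ ξ₀ ∈ K, ∀ᶠ q in nhds ((0 : ℝ), ξ₀), q.2 ∈ K →
      X q ∈ tube (G '' O) n ε ∧ (0 < q.1 →
        0 < ⟪X q - P (X q), n (P (X q))⟫ ∧ X q ∈ tubePlus (G '' O) n ε) := by
    intro ξ₀ hξ₀
    obtain ⟨a, ha, rfl⟩ := hKΓ hξ₀
    have hXtendsto : Filter.Tendsto X (nhds (0, G a)) (nhds (G a)) := by
      simpa [hX0] using hX.continuous.tendsto (0, G a)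
    have htube := hXtendsto.eventually (eventually_mem_tube hOopen hObdd hG_smooth.continuousOn
      hG_bij.injOn (fun z hz => (hGdiff z hz).differentiableAt one_ne_zero) hG_imm hn hε ha)
    have hside := eventually_inner_sub_unitNormal_pos hObdd hG_smooth.continuousOn
      hG_bij.injOn hGdiff hG_imm ha hX.contDiffAt hX0 (hXode 0 (G a)) (by
        have := hun (G a) (mem_image_of_mem G ha)
        rw [hn a ha] at this
        rw [hX0, inner_neg_left]
        exact neg_pos.2 this)
    have hclose : ∀ᶠ q in nhds ((0 : ℝ), G a), dist (X q) q.2 < ε :=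
      (hX.continuous.dist continuous_snd).continuousAt.eventually_lt_const (by simpa [hX0] using hε)
    filter_upwards [htube, hside, hclose] with q htube hside hclose hqK
    refine ⟨htube, fun hq => ?_⟩
    obtain ⟨hPΓ, hPdist, -⟩ := hP (X q) htube
    obtain ⟨z, hz, hzP⟩ := hPΓ
    have hmin : ∀ y ∈ G '' O, dist (X q) (G z) ≤ dist (X q) y := fun y hy => by
      rw [hzP, hPdist]
      exact infDist_le_dist_of_mem hy
    have hnz : n (G z) = unitNormal (fderiv ℝ G z) := hn z hz
    have hpos := hside hq (hKΓ hqK) z hz (hmin _ (hKΓ hqK))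
    rw [← hzP, hnz]
    refine ⟨hpos, G z, mem_image_of_mem G hz, _, ⟨hpos, ?_⟩, ?_⟩
    · refine (real_inner_le_norm _ _).trans_lt ?_
      rw [norm_unitNormal (hG_imm z hz), mul_one, ← dist_eq_norm]
      exact (hmin _ (hKΓ hqK)).trans_lt hclose
    · rw [hnz]
      exact eq_add_inner_smul_unitNormal hOopen hz ((hGdiff z hz).differentiableAt one_ne_zero)
        (hG_imm z hz) fun y hy => hmin _ (mem_image_of_mem G hy)
  obtain ⟨δ, hδ, hball⟩ := Metric.eventually_nhds_iff_ball.1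
    (hK.eventually_forall_of_forall_eventually (P := fun s ξ => ξ ∈ K →
      X (s, ξ) ∈ tube (G '' O) n ε ∧ (0 < s →
        0 < ⟪X (s, ξ) - P (X (s, ξ)), n (P (X (s, ξ)))⟫ ∧ X (s, ξ) ∈ tubePlus (G '' O) n ε)) hlocal)
  have hmem : ∀ s ∈ Ioo (-δ) δ, s ∈ ball (0 : ℝ) δ := fun s hs => by
    rwa [mem_ball_zero_iff, Real.norm_eq_abs, abs_lt]
  exact ⟨δ, hδ, fun ξ hξ => ⟨fun s hs => (hball s (hmem s hs) ξ hξ hξ).1,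
    fun s hs => (hball s (hmem s ⟨by linarith [hs.1], hs.2⟩) ξ hξ hξ).2 hs.1⟩⟩
end
end

section
/- Let d ≥ 2, M ≥ 1, let O ⊂ ℝ^d be a measurable set, and let (v_n) be a sequence in L¹(O;ℝ^M) converging weakly in L¹ to v. Let Φ : ℝ^M → (−∞,∞] be a lower semicontinuous convex function with Φ∘v_n ∈ L¹(O) for every n, and suppose Φ∘v_n converges weakly in L¹(O) to a function Φ̄ ∈ L¹(O). Then: (1) Φ(v(x)) ≤ Φ̄(x) for a.e. x ∈ O. (2) If moreover Φ is strictly convex on an open convex set U ⊂ ℝ^M and Φ(v(x)) = Φ̄(x) for a.e. x ∈ O, then there exists a subsequence (v_{n_k}) such that v_{n_k}(y) → v(y) for a.e. y in the set { y ∈ O : v(y) ∈ U }. -/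
open MeasureTheory Filter
open scoped RealInnerProductSpace Topology

section Convex

variable {E : Type*} [NormedAddCommGroup E] [InnerProductSpace ℝ E]

/-- `p` is a subgradient at `z` of the function `F` with domain `D`. -/
def IsSubgradientOn (D : Set E) (F : E → ℝ) (z p : E) : Prop :=
  ∀ w ∈ D, F z + ⟪w - z, p⟫ ≤ F w

/-- The defect in the midpoint convexity inequality of `F` between `w` and `z`. -/
noncomputable def midpointGap (F : E → ℝ) (w z : E) : ℝ :=
  2⁻¹ * F w + 2⁻¹ * F z - F ((2⁻¹ : ℝ) • (w + z))

theorem ConvexOn.exists_isSubgradientOn [FiniteDimensional ℝ E] {D : Set E} {F : E → ℝ}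
    (hF : ConvexOn ℝ D F) {z : E} (hz : z ∈ interior D) : ∃ p, IsSubgradientOn D F z p := by
  have hFi : ConvexOn ℝ (interior D) F := hF.subset interior_subset hF.1.interior
  have hcont : ContinuousOn F (interior D) := hFi.continuousOn isOpen_interior
  have hopen : IsOpen {q : E × ℝ | q.1 ∈ interior D ∧ F q.1 < q.2} := by
    have hO : IsOpen (Prod.fst ⁻¹' interior D : Set (E × ℝ)) :=
      isOpen_interior.preimage continuous_fst
    have hc : ContinuousOn (fun q : E × ℝ => q.2 - F q.1) (Prod.fst ⁻¹' interior D) :=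
      continuous_snd.continuousOn.sub (hcont.comp continuous_fst.continuousOn fun q hq => hq)
    convert hc.isOpen_inter_preimage hO (isOpen_Ioi (a := (0 : ℝ))) using 1
    ext q
    simp
  obtain ⟨l, hl⟩ := geometric_hahn_banach_open_point hFi.convex_strict_epigraph hopen
    (x := (z, F z)) (by simp)
  have hsplit : ∀ (w : E) (s : ℝ), l (w, s) = l (w, 0) + s * l (0, 1) := by
    intro w s
    have : (w, s) = (w, (0 : ℝ)) + s • ((0 : E), (1 : ℝ)) := by simp
    rw [this, map_add, map_smul, smul_eq_mul]
  set β := l (0, 1)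
  have hneg : β < 0 := by
    have := hl (z, F z + 1) ⟨hz, by simp⟩
    rw [hsplit z (F z + 1), hsplit z (F z)] at this
    linarith
  set m : E →L[ℝ] ℝ := l.comp (ContinuousLinearMap.inl ℝ E ℝ)
  have hm : ∀ w, l (w, 0) = m w := fun w => rfl
  have key : ∀ w ∈ interior D, m w - m z ≤ -β * (F w - F z) := by
    intro w hw
    refine le_of_forall_pos_le_add fun ε hε => ?_
    have := hl (w, F w + ε / (-β)) ⟨hw, by
      have : 0 < ε / (-β) := by apply div_pos hε; linarith
      simpa using this⟩
    rw [hsplit w, hsplit z, hm, hm] at this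
    have h2 : ε / (-β) * β = -ε := by
      have := hneg.ne
      field_simp
    nlinarith
  refine ⟨(InnerProductSpace.toDual ℝ E).symm ((-β)⁻¹ • m), fun w hw => ?_⟩
  rw [real_inner_comm, InnerProductSpace.toDual_symm_apply]
  obtain ⟨t, ht, htD⟩ : ∃ t ∈ Set.Ioo (0 : ℝ) 1, z + t • (w - z) ∈ interior D := by
    have hc : ContinuousAt (fun t : ℝ => z + t • (w - z)) 0 := by fun_prop
    have h1 : ∀ᶠ t in 𝓝[>] (0 : ℝ), z + t • (w - z) ∈ interior D :=
      (hc.eventually_mem (by simpa using isOpen_interior.mem_nhds hz)).filter_mono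
        nhdsWithin_le_nhds
    have h2 : ∀ᶠ t in 𝓝[>] (0 : ℝ), t ∈ Set.Ioo (0 : ℝ) 1 := Ioo_mem_nhdsGT one_pos
    obtain ⟨t, h⟩ := (h2.and h1).exists
    exact ⟨t, h⟩
  have h1 := key _ htD
  have h2 := hF.2 (interior_subset hz) hw (show 0 ≤ 1 - t by linarith [ht.2]) ht.1.le
    (by ring)
  have h3 : (1 - t) • z + t • w = z + t • (w - z) := by module
  rw [h3, smul_eq_mul, smul_eq_mul] at h2
  rw [map_add, map_smul, smul_eq_mul] at h1
  have hβ' : 0 < -β := by linarith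
  have h4 : t * m (w - z) ≤ t * (-β * (F w - F z)) := by nlinarith
  have h5 := le_of_mul_le_mul_left h4 ht.1
  have h6 : (-β)⁻¹ * m (w - z) ≤ F w - F z := by
    rw [inv_mul_le_iff₀ hβ']
    exact h5
  simp only [smul_apply, smul_eq_mul]
  linarith

theorem LipschitzOnWith.norm_le_of_isSubgradientOn {D W : Set E} {F : E → ℝ} {K : NNReal}
    (hF : LipschitzOnWith K F W) (hW : IsOpen W) (hWD : W ⊆ D) {z p : E} (hz : z ∈ W)
    (hp : IsSubgradientOn D F z p) : ‖p‖ ≤ K := by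
  obtain ⟨t, ht, htW⟩ : ∃ t > (0 : ℝ), z + t • p ∈ W := by
    have hc : ContinuousAt (fun t : ℝ => z + t • p) 0 := by fun_prop
    have h1 : ∀ᶠ t in 𝓝[>] (0 : ℝ), z + t • p ∈ W :=
      (hc.eventually_mem (by simpa using hW.mem_nhds hz)).filter_mono nhdsWithin_le_nhds
    obtain ⟨t, h⟩ := ((eventually_mem_nhdsWithin (a := (0 : ℝ)) (s := Set.Ioi 0)).and h1).exists
    exact ⟨t, h⟩
  have h1 := hp _ (hWD htW)
  have h2 := hF.dist_le_mul _ htW _ hz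
  rw [Real.dist_eq, dist_eq_norm, add_sub_cancel_left, norm_smul, Real.norm_eq_abs,
    abs_of_pos ht] at h2
  rw [add_sub_cancel_left, real_inner_smul_left, real_inner_self_eq_norm_sq] at h1
  have h3 := (le_abs_self _).trans h2
  by_contra! hlt
  have hp0 : 0 < ‖p‖ := K.coe_nonneg.trans_lt hlt
  have : 0 < t * ‖p‖ := by positivity
  nlinarith

theorem ConvexOn.exists_forall_isSubgradientOn_norm_le [FiniteDimensional ℝ E] {D : Set E}
    {F : E → ℝ} (hF : ConvexOn ℝ D F) {z : E} (hz : z ∈ interior D) :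
    ∃ W, IsOpen W ∧ z ∈ W ∧ W ⊆ interior D ∧ ∃ L : ℝ, ∃ p : E → E,
      ∀ w ∈ W, IsSubgradientOn D F w (p w) ∧ ‖p w‖ ≤ L := by
  obtain ⟨K, t, ht, hK⟩ := hF.locallyLipschitzOn_interior hz
  rw [isOpen_interior.nhdsWithin_eq hz] at ht
  have hsub : interior t ∩ interior D ⊆ t := fun w hw => interior_subset hw.1
  choose! p hp using fun w (hw : w ∈ interior D) => hF.exists_isSubgradientOn hw
  refine ⟨interior t ∩ interior D, isOpen_interior.inter isOpen_interior,
    ⟨mem_interior_iff_mem_nhds.2 ht, hz⟩, Set.inter_subset_right, K, p, fun w hw => ?_⟩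
  refine ⟨hp w hw.2, (hK.mono hsub).norm_le_of_isSubgradientOn
    (isOpen_interior.inter isOpen_interior) (fun w hw => interior_subset hw.2) hw (hp w hw.2)⟩

theorem ConvexOn.midpointGap_lineMap_le {D : Set E} {F : E → ℝ} (hF : ConvexOn ℝ D F) {w z : E}
    (hw : w ∈ D) (hz : z ∈ D) {r : ℝ} (hr0 : 0 ≤ r) (hr1 : r ≤ 1) :
    midpointGap F (z + r • (w - z)) z ≤ midpointGap F w z := by
  have hy : (2⁻¹ : ℝ) • (z + r • (w - z) + z) ∈ D := by
    have : (2⁻¹ : ℝ) • (z + r • (w - z) + z) = (r / 2) • w + (1 - r / 2) • z := by module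
    rw [this]
    exact hF.1 hw hz (by linarith) (by linarith) (by ring)
  have h2r : (2 - r) ≠ 0 := by linarith
  have h2r' : 0 < 2 - r := by linarith
  have e1 : z + r • (w - z) =
      (r / (2 - r)) • w + ((2 - 2 * r) / (2 - r)) • (2⁻¹ : ℝ) • (z + r • (w - z) + z) := by
    match_scalars <;> field_simp <;> ring
  have e2 : (2⁻¹ : ℝ) • (w + z) =
      ((1 - r) / (2 - r)) • w + (1 / (2 - r)) • (2⁻¹ : ℝ) • (z + r • (w - z) + z) := by
    match_scalars <;> field_simp <;> ring
  have h1 := hF.2 hw hy (show 0 ≤ r / (2 - r) by positivity)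
    (show 0 ≤ (2 - 2 * r) / (2 - r) from div_nonneg (by linarith) h2r'.le) (by field_simp; ring)
  have h2 := hF.2 hw hy (show 0 ≤ (1 - r) / (2 - r) from div_nonneg (by linarith) h2r'.le)
    (show 0 ≤ 1 / (2 - r) by positivity) (by field_simp; ring)
  rw [← e1] at h1
  rw [← e2] at h2
  simp only [smul_eq_mul] at h1 h2
  unfold midpointGap
  have e3 : r / (2 - r) + 2 * ((1 - r) / (2 - r)) = 1 := by field_simp; ring
  have e4 : (2 - 2 * r) / (2 - r) + 2 * (1 / (2 - r)) = 2 := by field_simp; ring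
  have e5 : F (z + r • (w - z)) + 2 * F ((2⁻¹ : ℝ) • (w + z)) ≤
      (r / (2 - r) + 2 * ((1 - r) / (2 - r))) * F w +
      ((2 - 2 * r) / (2 - r) + 2 * (1 / (2 - r))) * F ((2⁻¹ : ℝ) • (z + r • (w - z) + z)) := by
    linarith
  rw [e3, e4] at e5
  linarith

theorem StrictConvexOn.tendsto_of_tendsto_midpointGap [FiniteDimensional ℝ E] {D U : Set E}
    {F : E → ℝ} (hF : ConvexOn ℝ D F) (hU : IsOpen U) (hUD : U ⊆ D) (hFU : StrictConvexOn ℝ U F)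
    {z : E} (hz : z ∈ U) {ι : Type*} {l : Filter ι} {w : ι → E} (hw : ∀ i, w i ∈ D)
    (hlim : Tendsto (fun i => midpointGap F (w i) z) l (𝓝 0)) : Tendsto w l (𝓝 z) := by
  obtain ⟨R, hR, hRU⟩ := Metric.isOpen_iff.1 hU z hz
  rw [Metric.tendsto_nhds]
  intro ε hε
  set r := min ε (R / 2)
  have hr0 : 0 < r := by positivity
  have hsub : Metric.closedBall z r ⊆ U :=
    (Metric.closedBall_subset_ball ((min_le_right _ _).trans_lt (by linarith))).trans hRU
  have hmid : ∀ y ∈ U, (2⁻¹ : ℝ) • (y + z) ∈ U := fun y hy => by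
    rw [smul_add]
    exact hFU.1 hy hz (by norm_num) (by norm_num) (by norm_num)
  have hcont : ContinuousOn (fun y => midpointGap F y z) (Metric.sphere z r) := by
    have hFc : ContinuousOn F U := hFU.convexOn.continuousOn hU
    refine ContinuousOn.mono (s := U) ?_ (Metric.sphere_subset_closedBall.trans hsub)
    unfold midpointGap
    refine ((continuousOn_const.mul hFc).add continuousOn_const).sub ?_
    exact hFc.comp (by fun_prop) hmid
  have hpos : ∀ y ∈ Metric.sphere z r, 0 < midpointGap F y z := by
    intro y hy
    have hyz : y ≠ z := by
      rintro rfl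
      simp [hr0.ne] at hy
    have := hFU.2 (hsub (Metric.sphere_subset_closedBall hy)) hz hyz
      (show (0 : ℝ) < 2⁻¹ by norm_num) (show (0 : ℝ) < 2⁻¹ by norm_num) (by norm_num)
    rw [← smul_add, smul_eq_mul, smul_eq_mul] at this
    unfold midpointGap
    linarith
  obtain ⟨δ, hδ, hδle⟩ : ∃ δ > 0, ∀ y ∈ Metric.sphere z r, δ ≤ midpointGap F y z := by
    rcases (Metric.sphere z r).eq_empty_or_nonempty with he | hne
    · exact ⟨1, one_pos, by simp [he]⟩
    · obtain ⟨y, hy, hmin⟩ := (isCompact_sphere z r).exists_isMinOn hne hcont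
      exact ⟨_, hpos y hy, fun y' hy' => hmin hy'⟩
  filter_upwards [hlim.eventually_lt_const hδ] with i hi
  by_contra! hfar
  have hd : r ≤ ‖w i - z‖ := (min_le_left _ _).trans (by rwa [← dist_eq_norm])
  have hd0 : 0 < ‖w i - z‖ := hr0.trans_le hd
  have h1 := hF.midpointGap_lineMap_le (hw i) (hUD hz) (r := r / ‖w i - z‖) (by positivity)
    ((div_le_one hd0).2 hd)
  have h2 := hδle (z + (r / ‖w i - z‖) • (w i - z)) (by
    rw [mem_sphere_iff_norm, add_sub_cancel_left, norm_smul, Real.norm_eq_abs,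
      abs_of_pos (by positivity)]
    field_simp)
  linarith

end Convex

section Measure

variable {X : Type*} [MeasurableSpace X] {μ : Measure X}
variable {E : Type*} [NormedAddCommGroup E] [InnerProductSpace ℝ E]

/-- Weak convergence in `L¹(μ; E)`, tested against bounded measurable functions. -/
def TendstoWeakL1 (μ : Measure X) (v : ℕ → X → E) (u : X → E) : Prop :=
  ∀ g : X → E, AEStronglyMeasurable g μ → (∃ C : ℝ, ∀ᵐ x ∂μ, ‖g x‖ ≤ C) →
    Tendsto (fun n => ∫ x, ⟪v n x, g x⟫ ∂μ) atTop (𝓝 (∫ x, ⟪u x, g x⟫ ∂μ))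

theorem TendstoWeakL1.restrict {v : ℕ → X → E} {u : X → E} (h : TendstoWeakL1 μ v u) {s : Set X}
    (hs : MeasurableSet s) : TendstoWeakL1 (μ.restrict s) v u := by
  rintro g hg ⟨C, hC⟩
  have key : ∀ w : X → E, ∫ x in s, ⟪w x, g x⟫ ∂μ = ∫ x, ⟪w x, s.indicator g x⟫ ∂μ := by
    intro w
    rw [← integral_indicator hs]
    congr 1 with x
    by_cases hx : x ∈ s <;> simp [hx]
  simp only [key]
  refine h _ ((aestronglyMeasurable_indicator_iff hs).2 hg) ⟨max C 0, ?_⟩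
  rw [ae_restrict_iff' hs] at hC
  filter_upwards [hC] with x hx
  by_cases hxs : x ∈ s
  · simpa [hxs] using Or.inl (hx hxs)
  · simp [hxs]

theorem TendstoWeakL1.tendsto_integral [IsFiniteMeasure μ] {v : ℕ → X → ℝ} {u : X → ℝ}
    (h : TendstoWeakL1 μ v u) : Tendsto (fun n => ∫ x, v n x ∂μ) atTop (𝓝 (∫ x, u x ∂μ)) := by
  simpa using h (fun _ => 1) aestronglyMeasurable_const ⟨1, by simp⟩

theorem TendstoWeakL1.congr {v v' : ℕ → X → E} {u u' : X → E} (h : TendstoWeakL1 μ v u)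
    (hv : ∀ n, v n =ᵐ[μ] v' n) (hu : u =ᵐ[μ] u') : TendstoWeakL1 μ v' u' := by
  intro g hg hC
  have key : ∀ {w w' : X → E}, w =ᵐ[μ] w' → ∫ x, ⟪w x, g x⟫ ∂μ = ∫ x, ⟪w' x, g x⟫ ∂μ :=
    fun hw => integral_congr_ae (hw.mono fun x hx => by simp only [hx])
  simpa only [key hu, fun n => key (hv n)] using h g hg hC

/-- Closed convex constraints on a pair of sequences pass to weak `L¹` limits. -/
theorem TendstoWeakL1.ae_mem_of_isClosed_convex [FiniteDimensional ℝ E] [SigmaFinite μ]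
    {v : ℕ → X → E} {u : X → E} {f : ℕ → X → ℝ} {g : X → ℝ}
    (hv : ∀ n, Integrable (v n) μ) (hu : Integrable u μ)
    (hf : ∀ n, Integrable (f n) μ) (hg : Integrable g μ)
    (hvu : TendstoWeakL1 μ v u) (hfg : TendstoWeakL1 μ f g)
    {C : Set (E × ℝ)} (hC : IsClosed C) (hconv : Convex ℝ C)
    (hmem : ∀ n, ∀ᵐ x ∂μ, (v n x, f n x) ∈ C) : ∀ᵐ x ∂μ, (u x, g x) ∈ C := by
  have : ProperSpace E := FiniteDimensional.proper_real E
  obtain ⟨l, c, hlc⟩ := RCLike.iInter_countable_halfSpaces_eq (𝕜 := ℝ) hconv hC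
  simp only [← hlc, RCLike.re_to_real, Set.mem_iInter, Set.mem_ofPred_eq, ae_all_iff] at hmem ⊢
  intro i
  have hsplit : ∃ (a : E) (b : ℝ), ∀ w s, l i (w, s) = ⟪w, a⟫ + s * b := by
    refine ⟨(InnerProductSpace.toDual ℝ E).symm ((l i).comp (ContinuousLinearMap.inl ℝ E ℝ)),
      l i (0, 1), fun w s => ?_⟩
    rw [real_inner_comm, InnerProductSpace.toDual_symm_apply]
    have : (w, s) = (w, (0 : ℝ)) + s • ((0 : E), (1 : ℝ)) := by simp
    rw [this, map_add, map_smul, smul_eq_mul]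
    rfl
  obtain ⟨a, b, hab⟩ := hsplit
  simp only [hab]
  have hint : ∀ {w : X → E} {s : X → ℝ}, Integrable w μ → Integrable s μ →
      Integrable (fun x => ⟪w x, a⟫ + s x * b) μ :=
    fun hw hs => (hw.inner_const a).add (hs.mul_const b)
  have hnonneg : 0 ≤ᵐ[μ] fun x => c i - (⟪u x, a⟫ + g x * b) := by
    refine ae_nonneg_of_forall_setIntegral_nonneg_of_sigmaFinite
      (fun s _ hs => (integrableOn_const hs.ne).sub (hint hu hg).integrableOn) fun s hsm hs => ?_
    have : IsFiniteMeasure (μ.restrict s) := ⟨by simpa using hs⟩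
    rw [integral_sub (integrable_const _) (hint hu hg).integrableOn,
      integral_add (hu.inner_const a).restrict (hg.mul_const b).restrict, sub_nonneg]
    have h1 := hvu.restrict hsm (fun _ => a) aestronglyMeasurable_const ⟨‖a‖, by simp⟩
    have h2 := (hfg.restrict hsm).tendsto_integral.mul_const b
    simp only [← integral_mul_const] at h2
    refine le_of_tendsto (h1.add h2) (Eventually.of_forall fun n => ?_)
    rw [← integral_add ((hv n).inner_const a).restrict ((hf n).mul_const b).restrict]
    refine integral_mono_ae (hint (hv n) (hf n)).integrableOn (integrable_const _) ?_
    exact ae_restrict_of_ae ((hmem n i).mono fun x hx => by simpa only [hab] using hx)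
  filter_upwards [hnonneg] with x hx
  simpa using hx

theorem MeasureTheory.Integrable.exists_simpleFunc_mem_lintegral_le [FiniteDimensional ℝ E]
    [IsFiniteMeasure μ] {u : X → E} (hu : Integrable u μ) {W : Set E} (hW : W.Nonempty)
    (huW : ∀ᵐ x ∂μ, u x ∈ W) {ε : ENNReal} (hε : 0 < ε) :
    ∃ s : SimpleFunc X E, (∀ x, s x ∈ W) ∧ ∫⁻ x, ‖s x - u x‖ₑ ∂μ ≤ ε := by
  have : ProperSpace E := FiniteDimensional.proper_real E
  borelize E
  obtain ⟨y, hy⟩ := hW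
  obtain ⟨u', hu', huu'⟩ := hu.aemeasurable
  have hi : Integrable (fun x => u' x - y) μ := (hu.congr huu').sub (integrable_const y)
  have hcl : ∀ᵐ x ∂μ, u' x ∈ closure W := by
    filter_upwards [huW, huu'] with x h1 h2
    exact subset_closure (h2 ▸ h1)
  have hlim := SimpleFunc.tendsto_approxOn_L1_enorm hu' hy hcl hi.2
  obtain ⟨n, hn⟩ := ((ENNReal.tendsto_nhds_zero.1 hlim) ε hε).exists
  refine ⟨SimpleFunc.approxOn u' hu' W y hy n, SimpleFunc.approxOn_mem hu' hy n, ?_⟩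
  refine (lintegral_congr_ae ?_).trans_le hn
  filter_upwards [huu'] with x hx
  rw [hx]

theorem tendsto_lintegral_midpointGap [FiniteDimensional ℝ E] [IsFiniteMeasure μ]
    {D W : Set E} {F : E → ℝ} (hD : Convex ℝ D) (hWD : W ⊆ D) {p : E → E} {L : ℝ}
    (hp : ∀ z ∈ W, IsSubgradientOn D F z (p z) ∧ ‖p z‖ ≤ L)
    {v : ℕ → X → E} {u : X → E} (hv : ∀ n, Integrable (v n) μ) (hu : Integrable u μ)
    (hFv : ∀ n, Integrable (fun x => F (v n x)) μ) (hFu : Integrable (fun x => F (u x)) μ)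
    (hvD : ∀ n, ∀ᵐ x ∂μ, v n x ∈ D) (huW : ∀ᵐ x ∂μ, u x ∈ W)
    (hweak : TendstoWeakL1 μ v u)
    (hlim : Tendsto (fun n => ∫ x, F (v n x) ∂μ) atTop (𝓝 (∫ x, F (u x) ∂μ))) :
    Tendsto (fun n => ∫⁻ x, ENNReal.ofReal (midpointGap F (v n x) (u x)) ∂μ) atTop (𝓝 0) := by
  rcases W.eq_empty_or_nonempty with rfl | hWne
  · have : μ = 0 := by simpa using huW
    simp [this]
  have hL : 0 ≤ L := by
    obtain ⟨z, hz⟩ := hWne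
    exact (norm_nonneg _).trans (hp z hz).2
  suffices H : ∀ ε : ℝ, 0 < ε → ∀ᶠ n in atTop,
      ∫⁻ x, ENNReal.ofReal (midpointGap F (v n x) (u x)) ∂μ ≤ ENNReal.ofReal ε by
    rw [ENNReal.tendsto_nhds_zero]
    intro ε hε
    rcases eq_or_ne ε ⊤ with rfl | htop
    · simp
    · simpa [ENNReal.ofReal_toReal htop] using H ε.toReal (ENNReal.toReal_pos hε.ne' htop)
  intro ε hε
  obtain ⟨s, hsW, hs⟩ := hu.exists_simpleFunc_mem_lintegral_le hWne huW
    (ε := ENNReal.ofReal (ε / (2 * (2 * L + 1)))) (ENNReal.ofReal_pos.2 (by positivity))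
  have hsint : Integrable s μ := s.integrable_of_isFiniteMeasure
  have hFs : Integrable (fun x => F (s x)) μ := (s.map F).integrable_of_isFiniteMeasure
  have hps : AEStronglyMeasurable (fun x => p (s x)) μ := (s.map p).aestronglyMeasurable
  have hpb : ∀ᵐ x ∂μ, ‖p (s x)‖ ≤ L := ae_of_all _ fun x => (hp _ (hsW x)).2
  have hinner : ∀ {w : X → E}, Integrable w μ → Integrable (fun x => ⟪w x, p (s x)⟫) μ := by
    intro w hw
    refine (hw.norm.mul_const L).mono' (hw.1.inner hps) ?_
    filter_upwards [hpb] with x hx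
    exact (norm_inner_le_norm _ _).trans (by gcongr)
  -- the excess of `F` at `w` over the tangent plane at the approximating point
  set T : (X → E) → X → ℝ := fun w x => F (w x) - F (s x) - ⟪w x - s x, p (s x)⟫ with hT
  have hTint : ∀ {w : X → E}, Integrable w μ → Integrable (fun x => F (w x)) μ →
      Integrable (T w) μ := fun hw hFw => (hFw.sub hFs).sub (hinner (hw.sub hsint))
  have hTeq : ∀ {w : X → E}, Integrable w μ → Integrable (fun x => F (w x)) μ →
      ∫ x, T w x ∂μ = ∫ x, F (w x) ∂μ - ∫ x, F (s x) ∂μ -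
        (∫ x, ⟪w x, p (s x)⟫ ∂μ - ∫ x, ⟪s x, p (s x)⟫ ∂μ) := by
    intro w hw hFw
    have h1 : Integrable (fun x => F (w x) - F (s x)) μ := hFw.sub hFs
    have h2 : Integrable (fun x => ⟪w x, p (s x)⟫ - ⟪s x, p (s x)⟫) μ :=
      (hinner hw).sub (hinner hsint)
    simp only [hT, inner_sub_left]
    rw [integral_sub h1 h2, integral_sub hFw hFs, integral_sub (hinner hw) (hinner hsint)]
  have hTnonneg : ∀ {w : X → E}, (∀ᵐ x ∂μ, w x ∈ D) → 0 ≤ᵐ[μ] T w := by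
    intro w hw
    filter_upwards [hw] with x hx
    have := (hp _ (hsW x)).1 _ hx
    simp only [hT, Pi.zero_apply]
    linarith
  have huD : ∀ᵐ x ∂μ, u x ∈ D := huW.mono fun x hx => hWD hx
  have hTlim : Tendsto (fun n => 2⁻¹ * ∫ x, T (v n) x ∂μ + 2⁻¹ * ∫ x, T u x ∂μ) atTop
      (𝓝 (∫ x, T u x ∂μ)) := by
    have h1 : Tendsto (fun n => ∫ x, T (v n) x ∂μ) atTop (𝓝 (∫ x, T u x ∂μ)) := by
      rw [hTeq hu hFu]
      simp only [fun n => hTeq (hv n) (hFv n)]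
      exact (hlim.sub_const _).sub ((hweak _ hps ⟨L, hpb⟩).sub_const _)
    have h2 := (h1.const_mul (2⁻¹ : ℝ)).add_const (2⁻¹ * ∫ x, T u x ∂μ)
    rwa [← add_mul, show (2⁻¹ + 2⁻¹ : ℝ) = 1 by norm_num, one_mul] at h2
  have hTsmall : ∫ x, T u x ∂μ < ε := by
    have hnorm : ∫ x, ‖s x - u x‖ ∂μ ≤ ε / (2 * (2 * L + 1)) := by
      have hsu : AEStronglyMeasurable (fun x => s x - u x) μ := (hsint.sub hu).1
      rw [integral_norm_eq_lintegral_enorm hsu]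
      exact ENNReal.toReal_le_of_le_ofReal (by positivity) hs
    have hle : ∫ x, T u x ∂μ ≤ ∫ x, 2 * L * ‖s x - u x‖ ∂μ := by
      refine integral_mono_ae (hTint hu hFu) ((hsint.sub hu).norm.const_mul _) ?_
      filter_upwards [huW] with x hx
      have h1 := (hp _ hx).1 _ (hWD (hsW x))
      have h2 : |⟪s x - u x, p (u x)⟫| ≤ ‖s x - u x‖ * L :=
        (abs_real_inner_le_norm _ _).trans (by gcongr; exact (hp _ hx).2)
      have h3 : |⟪u x - s x, p (s x)⟫| ≤ ‖s x - u x‖ * L := by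
        rw [norm_sub_rev]
        exact (abs_real_inner_le_norm _ _).trans (by gcongr; exact (hp _ (hsW x)).2)
      simp only [hT]
      linarith [neg_abs_le ⟪s x - u x, p (u x)⟫, neg_abs_le ⟪u x - s x, p (s x)⟫]
    rw [integral_const_mul] at hle
    have h4 : 2 * L * ∫ x, ‖s x - u x‖ ∂μ ≤ 2 * L * (ε / (2 * (2 * L + 1))) := by gcongr
    have h5 : 2 * L * (ε / (2 * (2 * L + 1))) < ε := by
      rw [mul_div_assoc', div_lt_iff₀ (by positivity)]
      nlinarith
    linarith
  filter_upwards [hTlim.eventually_lt_const hTsmall] with n hn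
  have hRint : Integrable (fun x => 2⁻¹ * T (v n) x + 2⁻¹ * T u x) μ :=
    ((hTint (hv n) (hFv n)).const_mul _).add ((hTint hu hFu).const_mul _)
  calc ∫⁻ x, ENNReal.ofReal (midpointGap F (v n x) (u x)) ∂μ
      ≤ ∫⁻ x, ENNReal.ofReal (2⁻¹ * T (v n) x + 2⁻¹ * T u x) ∂μ := by
        refine lintegral_mono_ae ?_
        filter_upwards [hvD n, huD] with x h1 h2
        refine ENNReal.ofReal_le_ofReal ?_
        have h3 := (hp _ (hsW x)).1 ((2⁻¹ : ℝ) • (v n x + u x)) (by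
          rw [smul_add]
          exact hD h1 h2 (by norm_num) (by norm_num) (by norm_num))
        have h4 : (2⁻¹ : ℝ) • (v n x + u x) - s x =
            (2⁻¹ : ℝ) • (v n x - s x) + (2⁻¹ : ℝ) • (u x - s x) := by module
        rw [h4, inner_add_left, real_inner_smul_left, real_inner_smul_left] at h3
        simp only [hT, midpointGap]
        linarith
    _ = ENNReal.ofReal (∫ x, 2⁻¹ * T (v n) x + 2⁻¹ * T u x ∂μ) := by
        rw [ofReal_integral_eq_lintegral_ofReal hRint]
        filter_upwards [hTnonneg (hvD n), hTnonneg huD] with x h1 h2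
        simp only [Pi.zero_apply] at h1 h2 ⊢
        positivity
    _ ≤ ENNReal.ofReal ε := by
        rw [integral_add ((hTint (hv n) (hFv n)).const_mul _) ((hTint hu hFu).const_mul _),
          integral_const_mul, integral_const_mul]
        exact ENNReal.ofReal_le_ofReal hn.le

/-- If the integrals of `G n` tend to zero on each of countably many sets, a common subsequence
tends to zero almost everywhere on their union. -/
theorem exists_strictMono_forall_ae_tendsto_zero {A : ℕ → Set X} (hA : ∀ j, MeasurableSet (A j))
    {G : ℕ → X → ENNReal} (hG : ∀ n, AEMeasurable (G n) μ)
    (hlim : ∀ j, Tendsto (fun n => ∫⁻ x in A j, G n x ∂μ) atTop (𝓝 0)) :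
    ∃ φ : ℕ → ℕ, StrictMono φ ∧
      ∀ᵐ x ∂μ, ∀ j, x ∈ A j → Tendsto (fun k => G (φ k) x) atTop (𝓝 0) := by
  have hev : ∀ k : ℕ, ∀ᶠ n in atTop, ∀ j ∈ Finset.range (k + 1),
      ∫⁻ x in A j, G n x ∂μ ≤ (2⁻¹ : ENNReal) ^ k := by
    intro k
    rw [Finset.eventually_all]
    exact fun j _ => ENNReal.tendsto_nhds_zero.1 (hlim j) _ (by simp [pos_iff_ne_zero])
  obtain ⟨φ, hφ, hφle⟩ := extraction_forall_of_eventually hev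
  refine ⟨φ, hφ, ae_all_iff.2 fun j => (ae_restrict_iff' (hA j)).1 ?_⟩
  have hmeas : ∀ k, AEMeasurable (G (φ (k + j))) (μ.restrict (A j)) := fun k => (hG _).restrict
  have hsum : ∫⁻ x in A j, ∑' k, G (φ (k + j)) x ∂μ ≠ ⊤ := by
    rw [lintegral_tsum hmeas]
    refine ne_top_of_le_ne_top (b := ∑' k : ℕ, (2⁻¹ : ENNReal) ^ k) ?_
      (ENNReal.tsum_le_tsum fun k => ?_)
    · rw [ENNReal.tsum_geometric, ENNReal.one_sub_inv_two]
      simp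
    · refine (hφle (k + j) j (by simp)).trans ?_
      exact pow_le_pow_of_le_one (by simp) (by simp) (by simp)
  filter_upwards [ae_lt_top' (AEMeasurable.tsum hmeas) hsum] with x hx
  exact (tendsto_add_atTop_iff_nat j).1 (ENNReal.tendsto_atTop_zero_of_tsum_ne_top hx.ne)

theorem ConvexOn.midpointGap_nonneg {D : Set E} {F : E → ℝ} (hF : ConvexOn ℝ D F) {w z : E}
    (hw : w ∈ D) (hz : z ∈ D) : 0 ≤ midpointGap F w z := by
  have := hF.2 hw hz (show (0 : ℝ) ≤ 2⁻¹ by norm_num) (show (0 : ℝ) ≤ 2⁻¹ by norm_num)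
    (by norm_num)
  rw [← smul_add, smul_eq_mul, smul_eq_mul] at this
  unfold midpointGap
  linarith

theorem TendstoWeakL1.exists_subseq_ae_tendsto [FiniteDimensional ℝ E] [MeasurableSpace E]
    [BorelSpace E] [SigmaFinite μ] {D U : Set E} {F : E → ℝ} (hF : ConvexOn ℝ D F)
    (hFm : Measurable F) (hU : IsOpen U) (hUD : U ⊆ D) (hFU : StrictConvexOn ℝ U F)
    {v : ℕ → X → E} {u : X → E} (hv : ∀ n, Integrable (v n) μ) (hu : Integrable u μ)
    (hFv : ∀ n, Integrable (fun x => F (v n x)) μ) (hFu : Integrable (fun x => F (u x)) μ)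
    (hvD : ∀ n, ∀ᵐ x ∂μ, v n x ∈ D) (hvu : TendstoWeakL1 μ v u)
    (hFvu : TendstoWeakL1 μ (fun n x => F (v n x)) (fun x => F (u x))) :
    ∃ φ : ℕ → ℕ, StrictMono φ ∧
      ∀ᵐ x ∂μ, u x ∈ U → Tendsto (fun k => v (φ k) x) atTop (𝓝 (u x)) := by
  have : ProperSpace E := FiniteDimensional.proper_real E
  have hUi : U ⊆ interior D := interior_maximal hUD hU
  choose! W hWo hzW hWD L p hp using
    fun z (hz : z ∈ U) => hF.exists_forall_isSubgradientOn_norm_le (hUi hz)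
  obtain ⟨t, htU, htc, hcover⟩ := TopologicalSpace.countable_cover_nhdsWithin (f := W) (s := U)
    fun z hz => mem_nhdsWithin_of_mem_nhds ((hWo z hz).mem_nhds (hzW z hz))
  rcases t.eq_empty_or_nonempty with rfl | htne
  · refine ⟨id, strictMono_id, ae_of_all _ fun x hx => ?_⟩
    simpa using hcover hx
  obtain ⟨e, rfl⟩ := htc.exists_eq_range htne
  have heU : ∀ i, e i ∈ U := fun i => htU ⟨i, rfl⟩
  obtain ⟨u', hu', huu'⟩ := hu.aemeasurable
  set A : ℕ → Set X := fun k => u' ⁻¹' W (e k.unpair.1) ∩ spanningSets μ k.unpair.2 with hA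
  have hAm : ∀ k, MeasurableSet (A k) := fun k =>
    (hu' (hWo _ (heU _)).measurableSet).inter (measurableSet_spanningSets μ _)
  have hGm : ∀ n, AEMeasurable (fun x => ENNReal.ofReal (midpointGap F (v n x) (u x))) μ := by
    intro n
    have hvm := (hv n).aemeasurable
    have hum := hu.aemeasurable
    unfold midpointGap
    exact ((((hFm.comp_aemeasurable hvm).const_mul _).add
      ((hFm.comp_aemeasurable hum).const_mul _)).sub
      (hFm.comp_aemeasurable ((hvm.add hum).const_smul _))).ennreal_ofReal
  obtain ⟨φ, hφ, hlim⟩ := exists_strictMono_forall_ae_tendsto_zero (μ := μ) hAm hGm fun k => by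
    have : IsFiniteMeasure (μ.restrict (A k)) := ⟨by
      rw [Measure.restrict_apply_univ]
      exact (measure_mono Set.inter_subset_right).trans_lt (measure_spanningSets_lt_top μ _)⟩
    refine tendsto_lintegral_midpointGap hF.1 ((hWD _ (heU k.unpair.1)).trans interior_subset)
      (hp _ (heU k.unpair.1)) (fun n => (hv n).restrict) hu.restrict (fun n => (hFv n).restrict)
      hFu.restrict (fun n => ae_restrict_of_ae (hvD n)) ?_ (hvu.restrict (hAm k))
      (hFvu.restrict (hAm k)).tendsto_integral
    filter_upwards [ae_restrict_of_ae huu', ae_restrict_mem (hAm k)] with x hx hxA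
    rw [hx]
    exact hxA.1
  refine ⟨φ, hφ, ?_⟩
  filter_upwards [hlim, huu', ae_all_iff.2 hvD] with x hx hxu hxD hxU
  obtain ⟨i, hi⟩ : ∃ i, u x ∈ W (e i) := by simpa using hcover hxU
  obtain ⟨j, hj⟩ : ∃ j, x ∈ spanningSets μ j :=
    Set.mem_iUnion.1 ((iUnion_spanningSets μ).ge (Set.mem_univ x))
  have hgap := hx (Nat.pair i j) (by simpa [hA, ← hxu] using ⟨hi, hj⟩)
  refine StrictConvexOn.tendsto_of_tendsto_midpointGap hF hU hUD hFU hxU (fun k => hxD (φ k)) ?_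
  have := (ENNReal.tendsto_toReal ENNReal.zero_ne_top).comp hgap
  simpa [Function.comp_def, fun k => ENNReal.toReal_ofReal
    (hF.midpointGap_nonneg (hxD (φ k)) (hUD hxU))] using this

end Measure

section EReal

variable {E : Type*} [AddCommGroup E] [Module ℝ E] {Φ : E → EReal}

theorem EReal.convexOn_toReal (hbot : ∀ x, Φ x ≠ ⊥)
    (hconv : ∀ x y : E, ∀ t : ℝ, 0 ≤ t → t ≤ 1 →
      Φ (t • x + (1 - t) • y) ≤ (t : EReal) * Φ x + ((1 - t : ℝ) : EReal) * Φ y) :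
    ConvexOn ℝ {x | Φ x ≠ ⊤} (fun x => (Φ x).toReal) := by
  have key : ∀ ⦃x⦄, Φ x ≠ ⊤ → ∀ ⦃y⦄, Φ y ≠ ⊤ → ∀ ⦃a b : ℝ⦄, 0 ≤ a → 0 ≤ b → a + b = 1 →
      Φ (a • x + b • y) ≤ ((a * (Φ x).toReal + b * (Φ y).toReal : ℝ) : EReal) := by
    intro x hx y hy a b ha hb hab
    obtain rfl : b = 1 - a := by linarith
    have := hconv x y a ha (by linarith)
    rwa [← EReal.coe_toReal hx (hbot x), ← EReal.coe_toReal hy (hbot y), ← EReal.coe_mul,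
      ← EReal.coe_mul, ← EReal.coe_add] at this
  exact ⟨fun x hx y hy a b ha hb hab =>
      ne_top_of_le_ne_top (EReal.coe_ne_top _) (key hx hy ha hb hab),
    fun x hx y hy a b ha hb hab => by
      have := EReal.toReal_le_toReal (key hx hy ha hb hab) (hbot _) (EReal.coe_ne_top _)
      rwa [EReal.toReal_coe] at this⟩

theorem EReal.strictConvexOn_toReal (hbot : ∀ x, Φ x ≠ ⊥) {U : Set E} (hU : Convex ℝ U)
    (htop : ∀ x ∈ U, Φ x ≠ ⊤)
    (hconv : ∀ x ∈ U, ∀ y ∈ U, x ≠ y → ∀ t ∈ Set.Ioo (0 : ℝ) 1,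
      Φ (t • x + (1 - t) • y) < (t : EReal) * Φ x + ((1 - t : ℝ) : EReal) * Φ y) :
    StrictConvexOn ℝ U (fun x => (Φ x).toReal) := by
  refine ⟨hU, fun x hx y hy hxy a b ha hb hab => ?_⟩
  have hmem := hU hx hy ha.le hb.le hab
  obtain rfl : b = 1 - a := by linarith
  have := hconv x hx y hy hxy a ⟨ha, by linarith⟩
  rw [← EReal.coe_toReal (htop x hx) (hbot x), ← EReal.coe_toReal (htop y hy) (hbot y),
    ← EReal.coe_toReal (htop _ hmem) (hbot _), ← EReal.coe_mul, ← EReal.coe_mul,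
    ← EReal.coe_add, EReal.coe_lt_coe_iff] at this
  exact this

theorem ne_top_of_isOpen_of_strictConvex {E : Type*} [NormedAddCommGroup E] [NormedSpace ℝ E]
    [Nontrivial E] {Φ : E → EReal} {U : Set E} (hU : IsOpen U)
    (hconv : ∀ x ∈ U, ∀ y ∈ U, x ≠ y → ∀ t ∈ Set.Ioo (0 : ℝ) 1,
      Φ (t • x + (1 - t) • y) < (t : EReal) * Φ x + ((1 - t : ℝ) : EReal) * Φ y)
    {z : E} (hz : z ∈ U) : Φ z ≠ ⊤ := by
  obtain ⟨e, he⟩ := exists_ne (0 : E)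
  obtain ⟨t, ht, h1, h2⟩ : ∃ t > (0 : ℝ), z + t • e ∈ U ∧ z - t • e ∈ U := by
    have h1 : ∀ᶠ t in 𝓝[>] (0 : ℝ), z + t • e ∈ U :=
      (ContinuousAt.eventually_mem (f := fun t : ℝ => z + t • e) (by fun_prop)
        (by simpa using hU.mem_nhds hz)).filter_mono nhdsWithin_le_nhds
    have h2 : ∀ᶠ t in 𝓝[>] (0 : ℝ), z - t • e ∈ U :=
      (ContinuousAt.eventually_mem (f := fun t : ℝ => z - t • e) (by fun_prop)
        (by simpa using hU.mem_nhds hz)).filter_mono nhdsWithin_le_nhds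
    obtain ⟨t, h⟩ := ((eventually_mem_nhdsWithin (a := (0 : ℝ)) (s := Set.Ioi 0)).and
      (h1.and h2)).exists
    exact ⟨t, h⟩
  have hne : z + t • e ≠ z - t • e := by
    intro h
    have h3 : (2 * t) • e = 0 := by
      have : (2 * t) • e = (z + t • e) - (z - t • e) := by module
      rw [this, h, sub_self]
    rcases smul_eq_zero.1 h3 with h4 | h4
    · linarith
    · exact he h4
  have h := hconv _ h1 _ h2 hne 2⁻¹ ⟨by norm_num, by norm_num⟩
  have hmid : (2⁻¹ : ℝ) • (z + t • e) + (1 - 2⁻¹ : ℝ) • (z - t • e) = z := by module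
  rw [hmid] at h
  exact h.ne_top

end EReal

/-- If `v_n ⇀ v` weakly in `L¹(O;ℝ^M)`, `Φ : ℝ^M → (-∞,∞]` is lower semicontinuous convex,
`Φ ∘ v_n ∈ L¹(O)` (realized a.e. by integrable real functions `f n`) and `Φ ∘ v_n ⇀ Φ̄`
weakly in `L¹(O)`, then `Φ(v) ≤ Φ̄` a.e.; if moreover `Φ` is strictly convex on an open convex
set `U` and `Φ(v) = Φ̄` a.e., then a subsequence of `v_n` converges to `v` a.e. on
`{v ∈ U}`. -/
theorem stmt8 (d M : ℕ) (hd : 2 ≤ d) (hM : 1 ≤ M)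
    (O : Set (EuclideanSpace ℝ (Fin d))) (hO : MeasurableSet O)
    (v : ℕ → EuclideanSpace ℝ (Fin d) → EuclideanSpace ℝ (Fin M))
    (vlim : EuclideanSpace ℝ (Fin d) → EuclideanSpace ℝ (Fin M))
    (hv : ∀ n, Integrable (v n) (volume.restrict O))
    (hvlim : Integrable vlim (volume.restrict O))
    (hweak : ∀ g : EuclideanSpace ℝ (Fin d) → EuclideanSpace ℝ (Fin M),
      AEStronglyMeasurable g (volume.restrict O) →
      (∃ C : ℝ, ∀ᵐ x ∂(volume.restrict O), ‖g x‖ ≤ C) →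
      Tendsto (fun n => ∫ x, ⟪v n x, g x⟫ ∂(volume.restrict O)) atTop
        (𝓝 (∫ x, ⟪vlim x, g x⟫ ∂(volume.restrict O))))
    (Φ : EuclideanSpace ℝ (Fin M) → EReal)
    (hΦbot : ∀ x, Φ x ≠ ⊥)
    (hΦlsc : LowerSemicontinuous Φ)
    (hΦconv : ∀ x y : EuclideanSpace ℝ (Fin M), ∀ t : ℝ, 0 ≤ t → t ≤ 1 →
      Φ (t • x + (1 - t) • y) ≤ (t : EReal) * Φ x + ((1 - t : ℝ) : EReal) * Φ y)
    (f : ℕ → EuclideanSpace ℝ (Fin d) → ℝ)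
    (hf_int : ∀ n, Integrable (f n) (volume.restrict O))
    (hf_eq : ∀ n, ∀ᵐ x ∂(volume.restrict O), Φ (v n x) = ((f n x : ℝ) : EReal))
    (Φbar : EuclideanSpace ℝ (Fin d) → ℝ)
    (hΦbar_int : Integrable Φbar (volume.restrict O))
    (hweakΦ : ∀ g : EuclideanSpace ℝ (Fin d) → ℝ,
      AEStronglyMeasurable g (volume.restrict O) →
      (∃ C : ℝ, ∀ᵐ x ∂(volume.restrict O), |g x| ≤ C) →
      Tendsto (fun n => ∫ x, f n x * g x ∂(volume.restrict O)) atTop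
        (𝓝 (∫ x, Φbar x * g x ∂(volume.restrict O)))) :
    (∀ᵐ x ∂(volume.restrict O), Φ (vlim x) ≤ ((Φbar x : ℝ) : EReal)) ∧
    (∀ U : Set (EuclideanSpace ℝ (Fin M)), IsOpen U → Convex ℝ U →
      (∀ x ∈ U, ∀ y ∈ U, x ≠ y → ∀ t ∈ Set.Ioo (0 : ℝ) 1,
        Φ (t • x + (1 - t) • y) < (t : EReal) * Φ x + ((1 - t : ℝ) : EReal) * Φ y) →
      (∀ᵐ x ∂(volume.restrict O), Φ (vlim x) = ((Φbar x : ℝ) : EReal)) →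
      ∃ φ : ℕ → ℕ, StrictMono φ ∧
        ∀ᵐ y ∂(volume.restrict O), vlim y ∈ U →
          Tendsto (fun k => v (φ k) y) atTop (𝓝 (vlim y))) := by
  set μ := volume.restrict O
  have hwv : TendstoWeakL1 μ v vlim := hweak
  have hwf : TendstoWeakL1 μ f Φbar := fun g hg hC => by
    simpa [mul_comm] using hweakΦ g hg hC
  have hconv := EReal.convexOn_toReal hΦbot hΦconv
  refine ⟨?_, fun U hU hUc hstrict heq => ?_⟩
  · have hclosed : IsClosed {q : EuclideanSpace ℝ (Fin M) × ℝ | Φ q.1 ≤ (q.2 : EReal)} :=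
      (lowerSemicontinuous_iff_isClosed_epigraph.1 hΦlsc).preimage
        (continuous_id.prodMap continuous_coe_real_ereal)
    have hepi : {q : EuclideanSpace ℝ (Fin M) × ℝ | Φ q.1 ≤ (q.2 : EReal)} =
        {q | q.1 ∈ {x | Φ x ≠ ⊤} ∧ (Φ q.1).toReal ≤ q.2} := by
      ext q
      constructor
      · intro h
        have htop : Φ q.1 ≠ ⊤ := ne_top_of_le_ne_top (EReal.coe_ne_top _) h
        exact ⟨htop, by simpa using EReal.toReal_le_toReal h (hΦbot _) (EReal.coe_ne_top _)⟩
      · rintro ⟨htop, h⟩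
        change Φ q.1 ≤ _
        rw [← EReal.coe_toReal htop (hΦbot _)]
        exact EReal.coe_le_coe_iff.2 h
    exact hwv.ae_mem_of_isClosed_convex hv hvlim hf_int hΦbar_int hwf hclosed
      (hepi ▸ hconv.convex_epigraph) fun n => (hf_eq n).mono fun x hx => hx.le
  · have : Nonempty (Fin M) := ⟨⟨0, hM⟩⟩
    have htop : U ⊆ {x | Φ x ≠ ⊤} := fun z hz => ne_top_of_isOpen_of_strictConvex hU hstrict hz
    have hfv : ∀ n, f n =ᵐ[μ] fun x => (Φ (v n x)).toReal := fun n =>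
      (hf_eq n).mono fun x hx => by simp [hx]
    have hfu : Φbar =ᵐ[μ] fun x => (Φ (vlim x)).toReal := heq.mono fun x hx => by simp [hx]
    exact hwv.exists_subseq_ae_tendsto hconv hΦlsc.measurable.ereal_toReal hU htop
      (EReal.strictConvexOn_toReal hΦbot hUc htop hstrict) hv hvlim
      (fun n => (hf_int n).congr (hfv n)) (hΦbar_int.congr hfu)
      (fun n => (hf_eq n).mono fun x hx => by simp [hx]) (hwf.congr hfv hfu)
end

section
/- Let d ≥ 1 and let O ⊂ ℝ^d be a domain. Let P, G : O × [0,∞) → [0,∞) be Carathéodory functions (measurable in the first variable, continuous in the second) such that for a.e. y ∈ O, the maps ϱ ↦ P(y,ϱ) and ϱ ↦ G(y,ϱ) are both nondecreasing and continuous on [0,∞). Let (ϱ_n) be a sequence in L¹(O) with ϱ_n ≥ 0 a.e., such that P(·,ϱ_n(·)) ⇀ P̄, G(·,ϱ_n(·)) ⇀ Ḡ, and P(·,ϱ_n(·))·G(·,ϱ_n(·)) ⇀ Q̄ weakly in L¹(O) (all compositions assumed to lie in L¹(O)). Then P̄(y)·Ḡ(y) ≤ Q̄(y) for a.e. y ∈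 O. -/
open MeasureTheory Filter
open scoped Topology

/-- Weak convergence in `L¹(O)`: `∫ f_n g → ∫ F g` for every bounded measurable `g`. -/
def WeakL1Tendsto {α : Type*} [MeasurableSpace α] (μ : MeasureTheory.Measure α)
    (f : ℕ → α → ℝ) (F : α → ℝ) : Prop :=
  ∀ g : α → ℝ, AEStronglyMeasurable g μ → (∃ C : ℝ, ∀ᵐ x ∂μ, |g x| ≤ C) →
    Tendsto (fun n => ∫ x, f n x * g x ∂μ) atTop (𝓝 (∫ x, F x * g x ∂μ))

/-- Almost everywhere inequalities that are affine in three sequences pass to the weak `L¹` limit,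
even if the coefficients are unbounded. -/
theorem WeakL1Tendsto.affine_nonneg {α : Type*} [MeasurableSpace α] {μ : Measure α} [SigmaFinite μ]
    {p g q : ℕ → α → ℝ} {p' g' q' : α → ℝ}
    (hp : WeakL1Tendsto μ p p') (hg : WeakL1Tendsto μ g g') (hq : WeakL1Tendsto μ q q')
    (ip : ∀ n, Integrable (p n) μ) (ig : ∀ n, Integrable (g n) μ) (iq : ∀ n, Integrable (q n) μ)
    (ip' : Integrable p' μ) (ig' : Integrable g' μ) (iq' : Integrable q' μ)
    {a b c e : α → ℝ} (ha : Measurable a) (hb : Measurable b) (hc : Measurable c)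
    (he : Measurable e)
    (h : ∀ n, ∀ᵐ y ∂μ, 0 ≤ p n y * a y + g n y * b y + q n y * c y + e y) :
    ∀ᵐ y ∂μ, 0 ≤ p' y * a y + g' y * b y + q' y * c y + e y := by
  set w : α → ℝ := fun y => (1 + |a y| + |b y| + |c y| + |e y|)⁻¹ with hw
  have hwpos : ∀ y, 0 < w y := fun y => by positivity
  have hwm : Measurable w := by fun_prop
  have bound : ∀ (f : α → ℝ), (∀ y, |f y| ≤ 1 + |a y| + |b y| + |c y| + |e y|) →
      ∀ y, |f y * w y| ≤ 1 := by
    intro f hf y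
    rw [abs_mul, abs_of_pos (hwpos y), hw, ← div_eq_mul_inv, div_le_one (by positivity)]
    exact hf y
  have ba := bound a fun y => by
    linarith [abs_nonneg (a y), abs_nonneg (b y), abs_nonneg (c y), abs_nonneg (e y)]
  have bb := bound b fun y => by
    linarith [abs_nonneg (a y), abs_nonneg (b y), abs_nonneg (c y), abs_nonneg (e y)]
  have bc := bound c fun y => by
    linarith [abs_nonneg (a y), abs_nonneg (b y), abs_nonneg (c y), abs_nonneg (e y)]
  have be := bound e fun y => by
    linarith [abs_nonneg (a y), abs_nonneg (b y), abs_nonneg (c y), abs_nonneg (e y)]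
  have imul : ∀ {u f : α → ℝ}, Integrable u μ → Measurable f → (∀ y, |f y * w y| ≤ 1) →
      ∀ A : Set α, Integrable (fun y => u y * (f y * w y)) (μ.restrict A) := by
    intro u f hu hf hb A
    exact hu.restrict.mul_bdd (c := 1) (hf.mul hwm).aestronglyMeasurable (ae_of_all _ hb)
  have ie : ∀ A : Set α, μ A < ⊤ → Integrable (fun y => e y * w y) (μ.restrict A) := by
    intro A hA
    have : IsFiniteMeasure (μ.restrict A) := ⟨by simpa using hA⟩
    exact Integrable.of_bound (he.mul hwm).aestronglyMeasurable 1 (ae_of_all _ be)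
  have lim : ∀ {u : ℕ → α → ℝ} {u' f : α → ℝ}, WeakL1Tendsto μ u u' → Measurable f →
      (∀ y, |f y * w y| ≤ 1) → ∀ A : Set α, MeasurableSet A →
      Tendsto (fun n => ∫ y in A, u n y * (f y * w y) ∂μ) atTop
        (𝓝 (∫ y in A, u' y * (f y * w y) ∂μ)) := by
    intro u u' f hu hf hb A hA
    have key := hu (A.indicator fun y => f y * w y)
      ((hf.mul hwm).indicator hA).aestronglyMeasurable
      ⟨1, ae_of_all _ fun y => by
        by_cases hy : y ∈ A
        · simpa [hy] using hb y
        · simp [hy]⟩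
    have conv : ∀ v : α → ℝ, ∫ y, v y * A.indicator (fun y => f y * w y) y ∂μ
        = ∫ y in A, v y * (f y * w y) ∂μ := by
      intro v
      rw [← integral_indicator hA]
      congr 1 with y
      by_cases hy : y ∈ A <;> simp [hy]
    simpa only [conv] using key
  have split : ∀ {u v z : α → ℝ}, Integrable u μ → Integrable v μ → Integrable z μ →
      ∀ A : Set α, μ A < ⊤ →
      IntegrableOn (fun y => (u y * a y + v y * b y + z y * c y + e y) * w y) A μ ∧
      ∫ y in A, (u y * a y + v y * b y + z y * c y + e y) * w y ∂μ
        = ∫ y in A, u y * (a y * w y) ∂μ + ∫ y in A, v y * (b y * w y) ∂μ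
          + ∫ y in A, z y * (c y * w y) ∂μ + ∫ y in A, e y * w y ∂μ := by
    intro u v z hu hv hz A hA
    have i1 := imul hu ha ba A
    have i2 := imul hv hb bb A
    have i3 := imul hz hc bc A
    have i4 := ie A hA
    have heq : (fun y => (u y * a y + v y * b y + z y * c y + e y) * w y)
        = fun y => u y * (a y * w y) + v y * (b y * w y) + z y * (c y * w y) + e y * w y := by
      ext y; ring
    rw [heq]
    refine ⟨((i1.add i2).add i3).add i4, ?_⟩
    rw [integral_add (by exact (i1.add i2).add i3) i4, integral_add (by exact i1.add i2) i3,
      integral_add i1 i2]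
  have main : 0 ≤ᵐ[μ] fun y => (p' y * a y + g' y * b y + q' y * c y + e y) * w y := by
    refine ae_nonneg_of_forall_setIntegral_nonneg_of_sigmaFinite
      (fun A _ hA => (split ip' ig' iq' A hA).1) fun A hAm hA => ?_
    rw [(split ip' ig' iq' A hA).2]
    refine ge_of_tendsto' ((((lim hp ha ba A hAm).add (lim hg hb bb A hAm)).add
      (lim hq hc bc A hAm)).add_const _) fun n => ?_
    rw [← (split (ip n) (ig n) (iq n) A hA).2]
    refine integral_nonneg_of_ae (ae_restrict_of_ae ?_)
    filter_upwards [h n] with y hy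
    exact mul_nonneg hy (hwpos y).le
  filter_upwards [main] with y hy
  exact nonneg_of_mul_nonneg_left hy (hwpos y)

/-- Two functions that are monotone on the same set are comonotone there. -/
theorem MonotoneOn.mul_sub_sub_nonneg {f g : ℝ → ℝ} {S : Set ℝ} (hf : MonotoneOn f S)
    (hg : MonotoneOn g S) {s t : ℝ} (hs : s ∈ S) (ht : t ∈ S) :
    0 ≤ (f s - f t) * (g s - g t) := by
  rcases le_total s t with hst | hst
  · exact mul_nonneg_of_nonpos_of_nonpos (sub_nonpos.2 (hf hs ht hst))
      (sub_nonpos.2 (hg hs ht hst))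
  · exact mul_nonneg (sub_nonneg.2 (hf ht hs hst)) (sub_nonneg.2 (hg ht hs hst))

/-- If `(f t - p) (g t - γ) ≥ p γ - q` for all rational `t ≥ 0` and `p` lies between `f 0` and
`sup f`, then `p γ ≤ q`. -/
theorem mul_le_of_forall_rat {f g : ℝ → ℝ} {p γ q : ℝ}
    (hf : ContinuousOn f (Set.Ici 0)) (hg : ContinuousOn g (Set.Ici 0))
    (hg0 : ∀ t, 0 ≤ t → 0 ≤ g t)
    (hlow : f 0 ≤ p) (hup : ∀ c : ℚ, (∀ k : ℕ, f k ≤ c) → p ≤ c)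
    (h : ∀ t : ℚ, p * γ - q ≤ (f (max (t : ℝ) 0) - p) * (g (max (t : ℝ) 0) - γ)) :
    p * γ ≤ q := by
  have hmax : ContinuousOn (fun t : ℝ => max t 0) Set.univ := by fun_prop
  have cf : Continuous fun t : ℝ => f (max t 0) :=
    continuousOn_univ.1 (hf.comp hmax fun t _ => le_max_right t 0)
  have cg : Continuous fun t : ℝ => g (max t 0) :=
    continuousOn_univ.1 (hg.comp hmax fun t _ => le_max_right t 0)
  have hreal : ∀ t : ℝ, p * γ - q ≤ (f (max t 0) - p) * (g (max t 0) - γ) := fun t =>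
    Rat.denseRange_cast.induction_on t (isClosed_le continuous_const
      ((cf.sub continuous_const).mul (cg.sub continuous_const))) h
  by_cases hk : ∃ k : ℕ, p ≤ f k
  · obtain ⟨k, hk⟩ := hk
    obtain ⟨t, ht, rfl⟩ := intermediate_value_Icc (Nat.cast_nonneg k)
      (hf.mono Set.Icc_subset_Ici_self) ⟨hlow, hk⟩
    have := hreal t
    rw [max_eq_left ht.1] at this
    linarith
  · push Not at hk
    by_contra! hlt
    have hgap : ∀ k : ℕ, p * γ - q ≤ (p - f k) * γ := by
      intro k
      have h1 := hreal k
      rw [max_eq_left (Nat.cast_nonneg k)] at h1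
      nlinarith [mul_nonneg (sub_nonneg.2 (hk k).le) (hg0 k (Nat.cast_nonneg k))]
    have hγ : 0 < γ := by
      have := hgap 0
      exact pos_of_mul_pos_right (lt_of_lt_of_le (sub_pos.2 hlt) this) (sub_nonneg.2 (hk 0).le)
    obtain ⟨c, hc1, hc2⟩ := exists_rat_btwn
      (sub_lt_self p (div_pos (sub_pos.2 hlt) hγ))
    refine absurd (hup c fun k => ?_) (not_le.2 hc2)
    have := (div_le_iff₀ hγ).2 (hgap k)
    linarith

/-- If `P(y,·)` and `G(y,·)` are nonnegative, nondecreasing and continuous in the second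
variable for a.e. `y`, and `P(·,ϱ_n) ⇀ P̄`, `G(·,ϱ_n) ⇀ Ḡ`, `P(·,ϱ_n)G(·,ϱ_n) ⇀ Q̄` weakly
in `L¹(O)` for a sequence `ϱ_n ≥ 0` in `L¹(O)`, then `P̄ Ḡ ≤ Q̄` a.e. in `O`. -/
theorem stmt9 (d : ℕ) (hd : 1 ≤ d)
    (O : Set (EuclideanSpace ℝ (Fin d))) (hOopen : IsOpen O) (hOconn : IsConnected O)
    (P G : EuclideanSpace ℝ (Fin d) → ℝ → ℝ)
    (hPmeas : ∀ ϱ : ℝ, 0 ≤ ϱ → Measurable (fun y => P y ϱ))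
    (hGmeas : ∀ ϱ : ℝ, 0 ≤ ϱ → Measurable (fun y => G y ϱ))
    (hPG : ∀ᵐ y ∂(volume.restrict O),
      (∀ ϱ : ℝ, 0 ≤ ϱ → 0 ≤ P y ϱ ∧ 0 ≤ G y ϱ) ∧
      MonotoneOn (P y) (Set.Ici (0 : ℝ)) ∧ ContinuousOn (P y) (Set.Ici (0 : ℝ)) ∧
      MonotoneOn (G y) (Set.Ici (0 : ℝ)) ∧ ContinuousOn (G y) (Set.Ici (0 : ℝ)))
    (ϱ : ℕ → EuclideanSpace ℝ (Fin d) → ℝ)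
    (hϱ_int : ∀ n, Integrable (ϱ n) (volume.restrict O))
    (hϱ_nonneg : ∀ n, ∀ᵐ y ∂(volume.restrict O), 0 ≤ ϱ n y)
    (Pbar Gbar Qbar : EuclideanSpace ℝ (Fin d) → ℝ)
    (hPcomp_int : ∀ n, Integrable (fun y => P y (ϱ n y)) (volume.restrict O))
    (hGcomp_int : ∀ n, Integrable (fun y => G y (ϱ n y)) (volume.restrict O))
    (hPGcomp_int : ∀ n, Integrable (fun y => P y (ϱ n y) * G y (ϱ n y)) (volume.restrict O))
    (hPbar_int : Integrable Pbar (volume.restrict O))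
    (hGbar_int : Integrable Gbar (volume.restrict O))
    (hQbar_int : Integrable Qbar (volume.restrict O))
    (hPweak : WeakL1Tendsto (volume.restrict O) (fun n y => P y (ϱ n y)) Pbar)
    (hGweak : WeakL1Tendsto (volume.restrict O) (fun n y => G y (ϱ n y)) Gbar)
    (hQweak : WeakL1Tendsto (volume.restrict O)
      (fun n y => P y (ϱ n y) * G y (ϱ n y)) Qbar) :
    ∀ᵐ y ∂(volume.restrict O), Pbar y * Gbar y ≤ Qbar y := by
  have affine := @WeakL1Tendsto.affine_nonneg _ _ (volume.restrict O) _ _ _ _ _ _ _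
    hPweak hGweak hQweak hPcomp_int hGcomp_int hPGcomp_int hPbar_int hGbar_int hQbar_int
  have hcomon : ∀ᵐ y ∂(volume.restrict O), ∀ t : ℚ,
      0 ≤ Pbar y * -G y (max (t : ℝ) 0) + Gbar y * -P y (max (t : ℝ) 0) + Qbar y * 1
        + P y (max (t : ℝ) 0) * G y (max (t : ℝ) 0) := by
    refine ae_all_iff.2 fun t => ?_
    have ht : (0 : ℝ) ≤ max (t : ℝ) 0 := le_max_right _ _
    refine affine (hGmeas _ ht).neg (hPmeas _ ht).neg measurable_const
      ((hPmeas _ ht).mul (hGmeas _ ht)) fun n => ?_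
    filter_upwards [hPG, hϱ_nonneg n] with y hy hϱ
    have := hy.2.1.mul_sub_sub_nonneg hy.2.2.2.1 hϱ ht
    linarith
  have hlow : ∀ᵐ y ∂(volume.restrict O),
      0 ≤ Pbar y * 1 + Gbar y * 0 + Qbar y * 0 + -P y 0 := by
    refine affine measurable_const measurable_const measurable_const
      (hPmeas 0 le_rfl).neg fun n => ?_
    filter_upwards [hPG, hϱ_nonneg n] with y hy hϱ
    have := hy.2.1 (Set.self_mem_Ici) hϱ hϱ
    linarith
  have hup : ∀ᵐ y ∂(volume.restrict O), ∀ c : ℚ,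
      0 ≤ Pbar y * {y | ∀ k : ℕ, P y k ≤ c}.indicator (fun _ => -1) y + Gbar y * 0 + Qbar y * 0
        + {y | ∀ k : ℕ, P y k ≤ c}.indicator (fun _ => (c : ℝ)) y := by
    refine ae_all_iff.2 fun c => ?_
    have hS : MeasurableSet {y | ∀ k : ℕ, P y k ≤ c} := by
      rw [Set.ofPred_forall]
      exact MeasurableSet.iInter fun k =>
        measurableSet_le (hPmeas k (Nat.cast_nonneg k)) measurable_const
    refine affine (measurable_const.indicator hS) measurable_const measurable_const
      (measurable_const.indicator hS) fun n => ?_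
    filter_upwards [hPG, hϱ_nonneg n] with y hy hϱ
    by_cases hyS : y ∈ {y | ∀ k : ℕ, P y k ≤ c}
    · obtain ⟨k, hk⟩ := exists_nat_ge (ϱ n y)
      have h1 := hy.2.1 hϱ (Set.mem_Ici.2 (Nat.cast_nonneg k)) hk
      have h2 : P y k ≤ c := hyS k
      simp only [Set.indicator_of_mem hyS]
      linarith
    · simp [Set.indicator_of_notMem hyS]
  filter_upwards [hPG, hcomon, hlow, hup] with y hy hy1 hy2 hy3
  refine mul_le_of_forall_rat (f := P y) (g := G y) hy.2.2.1 hy.2.2.2.2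
    (fun t ht => (hy.1 t ht).2) (by linarith) (fun c hc => ?_) fun t => ?_
  · have := hy3 c
    have hyS : y ∈ {y | ∀ k : ℕ, P y k ≤ c} := hc
    simp only [Set.indicator_of_mem hyS] at this
    linarith
  · linarith [hy1 t]
end

section
/- Let 0 ≤ a̲ < ā and let 𝒪 = {(R,Z) ∈ ℝ² : R > 0, a̲R < Z < āR}. Let P : cl(𝒪) → [0,∞) be continuous on cl(𝒪) and C¹ on cl(𝒪) with P(0,0) = 0. Define the Helmholtz function H(R,Z) = R ∫₁^R P(s, sZ/R)/s² ds for (R,Z) ∈ 𝒪 (and H(0,0) = 0). Then: (1) H ∈ C¹(𝒪) and H extends continuously to cl(𝒪); (2) H(1,Z) = 0 for every Z ∈ [a̲,ā]; (3) H satisfies the first-order PDE R ∂_R H(R,Z) + Z ∂_Z H(R,Z) − H(R,Z) = P(R,Z) for every (R,Z) ∈ 𝒪; (4) H is bounded below on cl(𝒪), i.e. there exists H̲ > −∞ with H(R,Z) ≥ H̲ for all (R,Z) ∈ cl(𝒪). -/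
open Set Filter Topology MeasureTheory

theorem ContinuousOn.intervalIntegral_parametric {X E : Type*} [TopologicalSpace X]
    [NormedAddCommGroup E] [NormedSpace ℝ E] {f : X × ℝ → E} {S : Set X} {a b : ℝ} (hab : a ≤ b)
    (hf : ContinuousOn f (S ×ˢ Icc a b)) :
    ContinuousOn (fun x => ∫ t in a..b, f (x, t)) S := by
  rw [continuousOn_iff_continuous_domRestrict]
  have hg : Continuous (Function.uncurry fun (x : S) (t : ℝ) => f (x, projIcc a b hab t)) :=
    hf.comp_continuous (by fun_prop) fun q => ⟨q.1.2, (projIcc a b hab q.2).2⟩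
  refine (intervalIntegral.continuous_parametric_intervalIntegral_of_continuous'
    (μ := volume) hg a b).congr fun x => ?_
  refine intervalIntegral.integral_congr fun t ht => ?_
  rw [uIcc_of_le hab] at ht
  simp [projIcc_of_mem hab ht]

theorem ContinuousOn.slice_right {X Y Z : Type*} [TopologicalSpace X] [TopologicalSpace Y]
    [TopologicalSpace Z] {g : X × Y → Z} {S : Set X} {T : Set Y} (hg : ContinuousOn g (S ×ˢ T))
    {x : X} (hx : x ∈ S) : ContinuousOn (fun t => g (x, t)) T :=
  hg.comp (by fun_prop) fun _ ht => ⟨hx, ht⟩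

theorem ContDiffOn.intervalIntegral_parametric {E F : Type*} [NormedAddCommGroup E]
    [NormedSpace ℝ E] [FiniteDimensional ℝ E] [NormedAddCommGroup F] [NormedSpace ℝ F]
    {f : E × ℝ → F} {U : Set E} {V : Set (E × ℝ)} {a b : ℝ}
    (hab : a ≤ b) (hU : IsOpen U) (hV : IsOpen V) (hUV : U ×ˢ Icc a b ⊆ V)
    (hf : ContDiffOn ℝ 1 f V) :
    ContDiffOn ℝ 1 (fun x => ∫ t in a..b, f (x, t)) U := by
  have : ProperSpace E := FiniteDimensional.proper ℝ E
  let f' : E × ℝ → E →L[ℝ] F := fun q => (fderiv ℝ f q).comp (.inl ℝ E ℝ)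
  have hf' : ContinuousOn f' (U ×ˢ Icc a b) :=
    ((hf.continuousOn_fderiv_of_isOpen hV le_rfl).mono hUV).clm_comp continuousOn_const
  have hfc : ContinuousOn f (U ×ˢ Icc a b) := hf.continuousOn.mono hUV
  have hderiv : ∀ x ∈ U, HasFDerivAt (fun x => ∫ t in a..b, f (x, t))
      (∫ t in a..b, f' (x, t)) x := by
    intro x hx
    obtain ⟨r, hr, hball⟩ := Metric.nhds_basis_closedBall.mem_iff.1 (hU.mem_nhds hx)
    obtain ⟨M, hM⟩ := ((isCompact_closedBall x r).prod isCompact_Icc).exists_bound_of_continuousOn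
      (hf'.mono (prod_mono hball subset_rfl))
    have hIoc {t : ℝ} (ht : t ∈ uIoc a b) : t ∈ Icc a b := by
      rw [uIoc_of_le hab] at ht
      exact Ioc_subset_Icc_self ht
    refine intervalIntegral.hasFDerivAt_integral_of_dominated_of_fderiv_le
      (F := fun x t => f (x, t)) (F' := fun x t => f' (x, t)) (bound := fun _ => M)
      (Metric.closedBall_mem_nhds x hr) ?_ ?_ (intervalIntegrable_iff.1
        ((hf'.slice_right hx).intervalIntegrable_of_Icc hab)).aestronglyMeasurable ?_
      intervalIntegrable_const ?_
    · filter_upwards [hU.mem_nhds hx] with y hy using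
        (intervalIntegrable_iff.1
          ((hfc.slice_right hy).intervalIntegrable_of_Icc hab)).aestronglyMeasurable
    · exact (hfc.slice_right hx).intervalIntegrable_of_Icc hab
    · exact .of_forall fun t ht y hy => hM (y, t) ⟨hy, hIoc ht⟩
    · refine .of_forall fun t ht y hy => ?_
      have hmem := hUV (mk_mem_prod (hball hy) (hIoc ht))
      have hd := ((hf.differentiableOn one_ne_zero).differentiableAt
        (hV.mem_nhds hmem)).hasFDerivAt
      exact hd.comp y (hasFDerivAt_prodMk_left (𝕜 := ℝ) y t)
  intro x hx
  exact (contDiffAt_one_iff.2 ⟨_, U, hU.mem_nhds hx, hf'.intervalIntegral_parametric hab,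
    hderiv⟩).contDiffWithinAt

theorem closure_open_cone {al au : ℝ} (hlt : al < au) :
    closure {p : ℝ × ℝ | 0 < p.1 ∧ al * p.1 < p.2 ∧ p.2 < au * p.1} =
      {p : ℝ × ℝ | 0 ≤ p.1 ∧ al * p.1 ≤ p.2 ∧ p.2 ≤ au * p.1} := by
  refine Subset.antisymm (closure_minimal (fun p hp => ⟨hp.1.le, hp.2.1.le, hp.2.2.le⟩) ?_) ?_
  · simp only [ofPred_and]
    exact (isClosed_le (by fun_prop) (by fun_prop)).inter
      ((isClosed_le (by fun_prop) (by fun_prop)).inter (isClosed_le (by fun_prop) (by fun_prop)))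
  · rintro p ⟨h0, h1, h2⟩
    have hlim : Tendsto (fun ε : ℝ => (p.1 + ε, p.2 + ε * ((al + au) / 2))) (𝓝[>] 0) (𝓝 p) := by
      refine Tendsto.mono_left ?_ nhdsWithin_le_nhds
      have hc : Continuous fun ε : ℝ => (p.1 + ε, p.2 + ε * ((al + au) / 2)) := by fun_prop
      simpa using hc.tendsto 0
    refine mem_closure_of_tendsto hlim ?_
    filter_upwards [self_mem_nhdsWithin] with ε (hε : 0 < ε)
    refine ⟨?_, ?_, ?_⟩ <;> nlinarith

/-- The Helmholtz function written as an integral over the fixed interval `[0, 1]`. -/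
theorem helmholtz_eq_integral_unit (P : ℝ × ℝ → ℝ) (p : ℝ × ℝ) :
    p.1 * ∫ s in (1 : ℝ)..p.1, P (s, s * p.2 / p.1) / s ^ 2 =
      p.1 * ((p.1 - 1) * ∫ t in (0 : ℝ)..1,
        P ((p.1 - 1) * t + 1, ((p.1 - 1) * t + 1) * p.2 / p.1) / ((p.1 - 1) * t + 1) ^ 2) := by
  rw [intervalIntegral.mul_integral_comp_mul_add
    (f := fun s => P (s, s * p.2 / p.1) / s ^ 2)]
  simp

theorem closed_cone_ray_mem {al au s : ℝ} {p : ℝ × ℝ}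
    (hp : al * p.1 ≤ p.2 ∧ p.2 ≤ au * p.1) (h0 : 0 < p.1) (hs : 0 ≤ s) :
    0 ≤ s ∧ al * s ≤ s * p.2 / p.1 ∧ s * p.2 / p.1 ≤ au * s := by
  obtain ⟨h1, h2⟩ := hp
  refine ⟨hs, ?_, ?_⟩
  · rw [le_div_iff₀ h0]; nlinarith
  · rw [div_le_iff₀ h0]; nlinarith

theorem segment_one_pos {R t : ℝ} (hR : 0 < R) (ht : t ∈ Icc (0 : ℝ) 1) :
    0 < (R - 1) * t + 1 := by
  obtain ⟨h0, h1⟩ := ht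
  rcases h0.eq_or_lt with rfl | h0 <;> nlinarith

/-- A pressure with linear growth at the vertex has a Helmholtz function of size `R |log R|`. -/
theorem abs_helmholtz_le {P : ℝ × ℝ → ℝ} {p : ℝ × ℝ} {C : ℝ} (h0 : 0 ≤ p.1) (h1 : p.1 ≤ 1)
    (hC : ∀ s ∈ Ioc p.1 1, 0 < p.1 → |P (s, s * p.2 / p.1)| ≤ C * s) :
    |p.1 * ∫ s in (1 : ℝ)..p.1, P (s, s * p.2 / p.1) / s ^ 2| ≤ C * |p.1 * Real.log p.1| := by
  rcases h0.eq_or_lt with h0 | h0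
  · simp [← h0]
  have hint : IntervalIntegrable (fun s : ℝ => C * s⁻¹) volume p.1 1 := by
    refine (intervalIntegral.intervalIntegrable_inv (fun s hs => ?_) continuousOn_id).const_mul C
    rw [uIcc_of_le h1] at hs
    exact (h0.trans_le hs.1).ne'
  have hle : |∫ s in p.1..1, P (s, s * p.2 / p.1) / s ^ 2| ≤ ∫ s in p.1..1, C * s⁻¹ := by
    rw [← Real.norm_eq_abs]
    refine intervalIntegral.norm_integral_le_of_norm_le h1 (.of_forall fun s hs => ?_) hint
    have hs0 : 0 < s := h0.trans hs.1
    rw [Real.norm_eq_abs, abs_div, abs_of_pos (pow_pos hs0 2), div_le_iff₀ (pow_pos hs0 2)]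
    calc _ ≤ C * s := hC s hs h0
      _ = C * s⁻¹ * s ^ 2 := by field_simp
  rw [intervalIntegral.integral_const_mul, integral_inv_of_pos h0 one_pos, one_div,
    Real.log_inv] at hle
  rw [intervalIntegral.integral_symm, abs_mul, abs_neg, abs_mul, abs_of_pos h0,
    abs_of_nonpos (Real.log_nonpos h0.le h1)]
  nlinarith

/-- Properties of the Helmholtz function `H(R,Z) = R ∫₁^R P(s, sZ/R)/s² ds` associated with a
pressure `P ≥ 0` which is `C¹` on the closure of the cone
`𝒪 = {(R,Z) : R > 0, a̲ R < Z < ā R}` and satisfies `P(0,0) = 0`: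
`H` is `C¹` on `𝒪` and continuous on `cl 𝒪`, `H(1,Z) = 0` for `Z ∈ [a̲,ā]`,
`H` solves `R ∂_R H + Z ∂_Z H - H = P` on `𝒪`, and `H` is bounded below on `cl 𝒪`. -/
theorem stmt11 (al au : ℝ) (hal : 0 ≤ al) (hlt : al < au)
    (O : Set (ℝ × ℝ)) (hO : O = {p : ℝ × ℝ | 0 < p.1 ∧ al * p.1 < p.2 ∧ p.2 < au * p.1})
    (P : ℝ × ℝ → ℝ)
    (hPC1 : ContDiffOn ℝ 1 P (closure O))
    (hPnonneg : ∀ p ∈ closure O, 0 ≤ P p)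
    (hP0 : P (0, 0) = 0)
    (H : ℝ × ℝ → ℝ)
    (hH : ∀ p : ℝ × ℝ, H p = p.1 * ∫ s in (1 : ℝ)..p.1, P (s, s * p.2 / p.1) / s ^ 2) :
    (ContDiffOn ℝ 1 H O ∧ ContinuousOn H (closure O)) ∧
    (∀ Z ∈ Set.Icc al au, H (1, Z) = 0) ∧
    (∀ p ∈ O, p.1 * fderiv ℝ H p (1, 0) + p.2 * fderiv ℝ H p (0, 1) - H p = P p) ∧
    (∃ Hlow : ℝ, ∀ p ∈ closure O, Hlow ≤ H p) := by
  have hcl : closure O = {p : ℝ × ℝ | 0 ≤ p.1 ∧ al * p.1 ≤ p.2 ∧ p.2 ≤ au * p.1} := by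
    rw [hO, closure_open_cone hlt]
  have hOopen : IsOpen O := by
    rw [hO]
    simp only [ofPred_and]
    exact (isOpen_lt (by fun_prop) (by fun_prop)).inter
      ((isOpen_lt (by fun_prop) (by fun_prop)).inter (isOpen_lt (by fun_prop) (by fun_prop)))
  have hOmem {p : ℝ × ℝ} (hp : p ∈ O) : 0 < p.1 ∧ al * p.1 < p.2 ∧ p.2 < au * p.1 := by
    rwa [hO] at hp
  have hclmem {p : ℝ × ℝ} (hp : p ∈ closure O) :
      0 ≤ p.1 ∧ al * p.1 ≤ p.2 ∧ p.2 ≤ au * p.1 := by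
    rwa [hcl] at hp
  have hray {p : ℝ × ℝ} (hp : p ∈ closure O) (h0 : 0 < p.1) {s : ℝ} (hs : 0 ≤ s) :
      (s, s * p.2 / p.1) ∈ closure O := by
    rw [hcl]
    exact closed_cone_ray_mem (hclmem hp).2 h0 hs
  have hH' : H = fun p => p.1 * ((p.1 - 1) * ∫ t in (0 : ℝ)..1,
      P ((p.1 - 1) * t + 1, ((p.1 - 1) * t + 1) * p.2 / p.1) / ((p.1 - 1) * t + 1) ^ 2) :=
    funext fun p => (hH p).trans (helmholtz_eq_integral_unit P p)
  have hC1 : ContDiffOn ℝ 1 H O := by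
    let V : Set ((ℝ × ℝ) × ℝ) := (O ×ˢ univ) ∩ {q | 0 < (q.1.1 - 1) * q.2 + 1}
    have hV : IsOpen V :=
      (hOopen.prod isOpen_univ).inter (isOpen_lt (by fun_prop) (by fun_prop))
    have hint := ContDiffOn.intervalIntegral_parametric (V := V) (U := O) (f := fun q =>
      P ((q.1.1 - 1) * q.2 + 1, ((q.1.1 - 1) * q.2 + 1) * q.1.2 / q.1.1) /
        ((q.1.1 - 1) * q.2 + 1) ^ 2) zero_le_one hOopen hV
      (fun q hq => ⟨⟨hq.1, mem_univ _⟩, segment_one_pos (hOmem hq.1).1 hq.2⟩) (by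
        refine ContDiffOn.div ?_ (by fun_prop) fun q hq => (pow_pos hq.2 2).ne'
        refine hPC1.comp (ContDiffOn.prodMk (by fun_prop) ?_) fun q hq => ?_
        · exact ContDiffOn.div (by fun_prop) (by fun_prop) fun q hq => (hOmem hq.1.1).1.ne'
        · exact hray (subset_closure hq.1.1) (hOmem hq.1.1).1 (le_of_lt hq.2))
    rw [hH']
    exact contDiffOn_fst.mul ((contDiffOn_fst.sub contDiffOn_const).mul hint)
  let T : Set (ℝ × ℝ) := closure O ∩ {p | p.1 ≤ 1}
  have hTcompact : IsCompact T := by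
    refine (isCompact_Icc (a := ((0, 0) : ℝ × ℝ)) (b := (1, au))).of_isClosed_subset
      (isClosed_closure.inter (isClosed_le continuous_fst continuous_const)) ?_
    rintro p ⟨hp, h1 : p.1 ≤ 1⟩
    obtain ⟨h0, hl, hu⟩ := hclmem hp
    exact ⟨⟨h0, by nlinarith⟩, ⟨h1, by nlinarith⟩⟩
  have hTconvex : Convex ℝ T := by
    have hconv : Convex ℝ O := by
      rintro x hx y hy a b ha hb hab
      obtain ⟨hx0, hx1, hx2⟩ := hOmem hx
      obtain ⟨hy0, hy1, hy2⟩ := hOmem hy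
      rw [hO]
      rcases ha.eq_or_lt with rfl | ha
      · obtain rfl : b = 1 := by linarith
        simpa using ⟨hy0, hy1, hy2⟩
      · refine ⟨?_, ?_, ?_⟩ <;> simp only [Prod.fst_add, Prod.snd_add, Prod.smul_fst,
          Prod.smul_snd, smul_eq_mul] <;> nlinarith
    exact hconv.closure.inter (convex_halfSpace_le (LinearMap.fst ℝ ℝ ℝ).isLinear 1)
  have hbound : ∃ C : ℝ, ∀ p ∈ closure O, p.1 ≤ 1 → |H p| ≤ C * |p.1 * Real.log p.1| := by
    obtain ⟨K, hK⟩ := LocallyLipschitzOn.exists_lipschitzOnWith_of_compact (f := P) hTcompact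
      fun p hp => ((hPC1.mono inter_subset_left) p hp).exists_lipschitzOnWith hTconvex
    have h0T : ((0, 0) : ℝ × ℝ) ∈ T := by
      refine ⟨?_, by simp⟩
      rw [hcl]
      simp
    refine ⟨K * (1 + au), fun p hp h1 => ?_⟩
    rw [hH]
    refine abs_helmholtz_le (hclmem hp).1 h1 fun s hs h0 => ?_
    have hs0 : 0 < s := h0.trans hs.1
    have hmem := hray hp h0 hs0.le
    have hdist := hK.dist_le_mul _ (show (s, s * p.2 / p.1) ∈ T from ⟨hmem, hs.2⟩) _ h0T
    rw [hP0, Real.dist_eq, sub_zero] at hdist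
    refine hdist.trans ?_
    rw [mul_assoc]
    refine mul_le_mul_of_nonneg_left ?_ K.2
    obtain ⟨-, hl, hu⟩ := hclmem hmem
    simp only at hl hu
    have hz : 0 ≤ s * p.2 / p.1 := (mul_nonneg hal hs0.le).trans hl
    rw [Prod.dist_eq, Real.dist_eq, Real.dist_eq, sub_zero, sub_zero, abs_of_pos hs0,
      abs_of_nonneg hz]
    exact max_le (by nlinarith) (by nlinarith)
  have hcont : ContinuousOn H (closure O) := by
    intro p hp
    rcases (hclmem hp).1.eq_or_lt with h0 | h0
    · obtain ⟨C, hC⟩ := hbound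
      have hHp : H p = 0 := by simp [hH, ← h0]
      have hlim : Tendsto (fun q : ℝ × ℝ => C * |q.1 * Real.log q.1|) (𝓝[closure O] p) (𝓝 0) := by
        have hc : Continuous fun q : ℝ × ℝ => C * |q.1 * Real.log q.1| :=
          continuous_const.mul (Real.continuous_mul_log.comp continuous_fst).abs
        simpa [← h0] using (hc.tendsto p).mono_left nhdsWithin_le_nhds
      rw [ContinuousWithinAt, hHp]
      refine squeeze_zero_norm' ?_ hlim
      have hlt_one : {q : ℝ × ℝ | q.1 < 1} ∈ 𝓝 p :=
        (isOpen_lt continuous_fst continuous_const).mem_nhds (by simp [← h0])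
      filter_upwards [self_mem_nhdsWithin, mem_nhdsWithin_of_mem_nhds hlt_one] with q hq hq1
      exact hC q hq (le_of_lt hq1)
    · have hS : ContinuousOn H (closure O ∩ {q | 0 < q.1}) := by
        have hint := ContinuousOn.intervalIntegral_parametric (S := closure O ∩ {q | 0 < q.1})
          (f := fun q => P ((q.1.1 - 1) * q.2 + 1, ((q.1.1 - 1) * q.2 + 1) * q.1.2 / q.1.1) /
            ((q.1.1 - 1) * q.2 + 1) ^ 2) zero_le_one (by
            refine ContinuousOn.div ?_ (by fun_prop) fun q hq =>
              (pow_pos (segment_one_pos hq.1.2 hq.2) 2).ne'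
            refine hPC1.continuousOn.comp (ContinuousOn.prodMk (by fun_prop) ?_) fun q hq => ?_
            · exact ContinuousOn.div (by fun_prop) (by fun_prop) fun q hq => (ne_of_gt hq.1.2)
            · exact hray hq.1.1 hq.1.2 (segment_one_pos hq.1.2 hq.2).le)
        rw [hH']
        exact continuousOn_fst.mul ((continuousOn_fst.sub continuousOn_const).mul hint)
      refine (hS p ⟨hp, h0⟩).mono_of_mem_nhdsWithin (inter_mem_nhdsWithin _ ?_)
      exact (isOpen_lt continuous_const continuous_fst).mem_nhds h0
  refine ⟨⟨hC1, hcont⟩, fun Z _ => by simp [hH], fun p hp => ?_, ?_⟩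
  · have h0 := (hOmem hp).1
    let g : ℝ → ℝ := fun s => P (s, s * p.2 / p.1) / s ^ 2
    have hg : ContinuousOn g (Ioi 0) := by
      refine ContinuousOn.div ?_ (by fun_prop) fun s hs => (pow_pos hs 2).ne'
      exact hPC1.continuousOn.comp (by fun_prop) fun s hs =>
        hray (subset_closure hp) h0 (le_of_lt hs)
    have hprim : HasDerivAt (fun u => ∫ s in (1 : ℝ)..u, g s) (g p.1) p.1 := by
      refine intervalIntegral.integral_hasDerivAt_right ?_
        (hg.stronglyMeasurableAtFilter isOpen_Ioi p.1 h0) (hg.continuousAt (Ioi_mem_nhds h0))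
      refine (hg.mono fun s hs => ?_).intervalIntegrable
      exact (lt_min one_pos h0).trans_le hs.1
    have hscale : HasDerivAt (fun c : ℝ => c * p.1) p.1 1 := by
      simpa using (hasDerivAt_id (1 : ℝ)).mul_const p.1
    have hray_deriv : HasDerivAt (fun c : ℝ => H (c • p)) (H p + P p) 1 := by
      have hcomp : HasDerivAt (fun c : ℝ => ∫ s in (1 : ℝ)..c * p.1, g s) (g p.1 * p.1) 1 :=
        HasDerivAt.comp (h₂ := fun u => ∫ s in (1 : ℝ)..u, g s) 1 (by simpa using hprim) hscale
      have hmul := hscale.mul hcomp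
      have hval : p.1 * (∫ s in (1 : ℝ)..1 * p.1, g s) + 1 * p.1 * (g p.1 * p.1) = H p + P p := by
        have hgp : g p.1 = P p / p.1 ^ 2 := by
          simp only [g]
          rw [mul_div_cancel_left₀ _ h0.ne']
        rw [hgp, hH p, one_mul]
        field_simp
        rfl
      rw [hval] at hmul
      refine hmul.congr_of_eventuallyEq ?_
      filter_upwards [Ioi_mem_nhds (zero_lt_one (α := ℝ))] with c (hc : 0 < c)
      simp only [hH, Pi.mul_apply, Prod.smul_fst, Prod.smul_snd, smul_eq_mul, g]
      congr 2
      ext s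
      rw [mul_left_comm, mul_div_mul_left _ _ hc.ne']
    have hfd : HasFDerivAt H (fderiv ℝ H p) ((1 : ℝ) • p) := by
      rw [one_smul]
      exact ((hC1.differentiableOn one_ne_zero).differentiableAt
        (hOopen.mem_nhds hp)).hasFDerivAt
    have hline : HasDerivAt (fun c : ℝ => c • p) p 1 := by
      simpa using (hasDerivAt_id (1 : ℝ)).smul_const p
    have heq := (hfd.comp_hasDerivAt 1 hline).unique hray_deriv
    have hdecomp : p = p.1 • ((1, 0) : ℝ × ℝ) + p.2 • ((0, 1) : ℝ × ℝ) := by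
      ext <;> simp
    have hlin : fderiv ℝ H p p = p.1 * fderiv ℝ H p (1, 0) + p.2 * fderiv ℝ H p (0, 1) := by
      conv_lhs => rw [hdecomp, map_add, map_smul, map_smul, ← hdecomp]
      simp
    linarith
  · obtain ⟨M, hM⟩ := hTcompact.exists_bound_of_continuousOn (hcont.mono inter_subset_left)
    refine ⟨min (-M) 0, fun p hp => ?_⟩
    rcases le_total p.1 1 with h1 | h1
    · exact (min_le_left _ _).trans (neg_le_of_abs_le (hM p ⟨hp, h1⟩))
    · refine (min_le_right _ _).trans ?_
      rw [hH]
      refine mul_nonneg (hclmem hp).1 (intervalIntegral.integral_nonneg h1 fun s hs => ?_)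
      exact div_nonneg (hPnonneg _ (hray hp (by linarith) (by linarith [hs.1]))) (sq_nonneg s)
end

section
/- Let γ ≥ 1 be a real number and let T : [0,∞) → ℝ be nondecreasing and 1-Lipschitz (|T(x) − T(y)| ≤ |x − y| for all x,y ≥ 0). Then for all a, b ≥ 0: |T(a) − T(b)|^{γ+1} ≤ (a^γ − b^γ)·(T(a) − T(b)). -/
/-- Superadditivity of `x ↦ x ^ p` on `[0, ∞)` for `p ≥ 1`, in subtractive form. -/
theorem sub_rpow_le_rpow_sub_rpow {p x y : ℝ} (hp : 1 ≤ p) (hy : 0 ≤ y) (hyx : y ≤ x) :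
    (x - y) ^ p ≤ x ^ p - y ^ p := by
  have h := NNReal.add_rpow_le_rpow_add ⟨x - y, sub_nonneg.2 hyx⟩ ⟨y, hy⟩ hp
  rw [← NNReal.coe_le_coe] at h
  push_cast at h
  change (x - y) ^ p + y ^ p ≤ (x - y + y) ^ p at h
  rw [sub_add_cancel] at h
  linarith

/-- If `γ ≥ 1` and `T : [0,∞) → ℝ` is nondecreasing and 1-Lipschitz, then for all
`a, b ≥ 0` one has `|T a - T b|^(γ+1) ≤ (a^γ - b^γ) * (T a - T b)`. -/
theorem stmt15 (γ : ℝ) (hγ : 1 ≤ γ) (T : ℝ → ℝ)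
    (hmono : ∀ x y : ℝ, 0 ≤ x → 0 ≤ y → x ≤ y → T x ≤ T y)
    (hlip : ∀ x y : ℝ, 0 ≤ x → 0 ≤ y → |T x - T y| ≤ |x - y|) :
    ∀ a b : ℝ, 0 ≤ a → 0 ≤ b →
      |T a - T b| ^ (γ + 1) ≤ (a ^ γ - b ^ γ) * (T a - T b) := by
  intro a b ha hb
  wlog hba : b ≤ a generalizing a b
  · have h := this b a hb ha (le_of_not_ge hba)
    rw [abs_sub_comm]
    linarith
  have hT : 0 ≤ T a - T b := sub_nonneg.2 (hmono b a hb ha hba)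
  have hle : T a - T b ≤ a - b := by
    simpa only [abs_of_nonneg hT, abs_of_nonneg (sub_nonneg.2 hba)] using hlip a b ha hb
  have hpow : (T a - T b) ^ γ ≤ a ^ γ - b ^ γ :=
    (Real.rpow_le_rpow hT hle (by linarith)).trans (sub_rpow_le_rpow_sub_rpow hγ hb hba)
  rw [abs_of_nonneg hT, Real.rpow_add_one' hT (by linarith)]
  exact mul_le_mul_of_nonneg_right hpow hT
end
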